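/- Let 𝓡 = (R, <, +, 0, …) be an expansion of a densely linearly ordered abelian group such that 𝓡 ⊨ DC and 𝓡 ⊨ LUF₂. Then the open core of 𝓡 is a uniformly locally o-minimal structure of the second kind. -/

import Mathlib

open FirstOrder Set Topology

section CommonDefs

/-- A subset of `R^n` (coded as `Fin n → R`) is definable in the structure `𝓡` (with
universe `R` and language `L`) with parameters. -/
def IsDefinable (L : FirstOrder.Language) {R : Type*} [L.Structure R] {n : ℕ}
    (X : Set (Fin n → R)) : Prop :=
  Set.Definable (Set.univ : Set R) L X

/-- An open box in `R^n`: a product of `n` open intervals. -/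
def OpenBox {R : Type*} [LT R] {n : ℕ} (B : Set (Fin n → R)) : Prop :=
  ∃ c d : Fin n → R, B = {x | ∀ i, c i < x i ∧ x i < d i}

/-- A closed box in `R^n`: a product of `n` closed intervals. -/
def ClosedBox {R : Type*} [LE R] {n : ℕ} (B : Set (Fin n → R)) : Prop :=
  ∃ c d : Fin n → R, B = {x | ∀ i, c i ≤ x i ∧ x i ≤ d i}

/-- A subset of `R` which is a finite union of points and open intervals. -/
def FinUnionPtsIntervals {R : Type*} [Preorder R] (s : Set R) : Prop :=
  ∃ (P : Finset R) (Q : Finset (R × R)), s = ↑P ∪ ⋃ p ∈ Q, Set.Ioo p.1 p.2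

/-- The fiber `X_x ⊆ R` of a set `X ⊆ R^{m+1}` over `x ∈ R^m`. -/
def fiber1 {R : Type*} {m : ℕ} (X : Set (Fin (m + 1) → R)) (x : Fin m → R) : Set R :=
  {y | Fin.snoc x y ∈ X}

/-- The fiber `X_x ⊆ R^n` of a set `X ⊆ R^{m+n}` over `x ∈ R^m`. -/
def fiberN {R : Type*} {m n : ℕ} (X : Set (Fin (m + n) → R)) (x : Fin m → R) :
    Set (Fin n → R) :=
  {y | Fin.append x y ∈ X}

/-- The member `X_{r,s} ⊆ R^n` of a parameterized family coded by `F ⊆ R^{2+n}`. -/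
def famFiber {R : Type*} {n : ℕ} (F : Set (Fin (2 + n) → R)) (r s : R) : Set (Fin n → R) :=
  {y | Fin.append ![r, s] y ∈ F}

/-- A bounded subset of `R^n`: contained in some closed box. -/
def BddSet {R : Type*} [LE R] {n : ℕ} (X : Set (Fin n → R)) : Prop :=
  ∃ c d : R, ∀ y ∈ X, ∀ i, c ≤ y i ∧ y i ≤ d

/-- A discrete subset of a topological space: each of its points is isolated. -/
def DiscreteSet {α : Type*} [TopologicalSpace α] (S : Set α) : Prop :=
  ∀ y ∈ S, ∃ U : Set α, IsOpen U ∧ y ∈ U ∧ U ∩ S = {y}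

/-- A locally finite subset: each point of the space has an open neighborhood meeting
the set in a finite set. -/
def LocFin {α : Type*} [TopologicalSpace α] (S : Set α) : Prop :=
  ∀ x : α, ∃ U : Set α, IsOpen U ∧ x ∈ U ∧ (S ∩ U).Finite

/-- `F ⊆ R^{2+n}` codes a `D_Σ`-family `{X_{r,s}}_{r>0,s>0}` of CBD subsets of `R^n`:
each fiber is closed, bounded and definable, the family is increasing in `r` and
decreasing in `s`. -/
def IsDSigmaFamily (L : FirstOrder.Language) {R : Type*} [L.Structure R] [LinearOrder R]
    [Zero R] [TopologicalSpace R] {n : ℕ} (F : Set (Fin (2 + n) → R)) : Prop :=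
  IsDefinable L F ∧
    (∀ r s : R, 0 < r → 0 < s →
      IsDefinable L (famFiber F r s) ∧ IsClosed (famFiber F r s) ∧ BddSet (famFiber F r s)) ∧
    (∀ r r' s : R, 0 < r → 0 < s → r ≤ r' → famFiber F r s ⊆ famFiber F r' s) ∧
    (∀ r s s' : R, 0 < r → 0 < s → s ≤ s' → famFiber F r s' ⊆ famFiber F r s)

/-- A `D_Σ`-set: the union `⋃_{r>0,s>0} X_{r,s}` of a `D_Σ`-family. -/
def IsDSigma (L : FirstOrder.Language) {R : Type*} [L.Structure R] [LinearOrder R]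
    [Zero R] [TopologicalSpace R] {n : ℕ} (X : Set (Fin n → R)) : Prop :=
  ∃ F : Set (Fin (2 + n) → R), IsDSigmaFamily L F ∧
    X = ⋃ (r : R) (_ : 0 < r) (s : R) (_ : 0 < s), famFiber F r s

/-- Constructible sets: finite boolean combinations of open sets. -/
inductive IsConstructibleSet {α : Type*} [TopologicalSpace α] : Set α → Prop
  | of_isOpen (s : Set α) : IsOpen s → IsConstructibleSet s
  | compl (s : Set α) : IsConstructibleSet s → IsConstructibleSet sᶜ
  | union (s t : Set α) : IsConstructibleSet s → IsConstructibleSet t →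
      IsConstructibleSet (s ∪ t)

/-- `𝓡 ⊨ DC`: every nonempty definable subset of `R` bounded above has a supremum. -/
def DCProp (L : FirstOrder.Language) (R : Type*) [L.Structure R] [Preorder R] : Prop :=
  ∀ s : Set R, IsDefinable L {v : Fin 1 → R | v 0 ∈ s} → s.Nonempty → BddAbove s →
    ∃ a : R, IsLUB s a

/-- `𝓡 ⊨ LUF₂` (locally uniform finiteness of the second kind). -/
def LUF2 (L : FirstOrder.Language) (R : Type*) [L.Structure R] [LinearOrder R]
    [TopologicalSpace R] : Prop :=
  ∀ (m : ℕ) (X : Set (Fin (m + 1) → R)), IsDefinable L X → ∀ (a : R) (b : Fin m → R),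
    ∃ N : ℕ, 0 < N ∧ ∃ p q : R, a ∈ interior (Set.Icc p q) ∧
      ∃ U : Set (Fin m → R), OpenBox U ∧ b ∈ U ∧
        ∀ x ∈ U, ∀ p' q' : R, a ∈ interior (Set.Icc p' q') → Set.Icc p' q' ⊆ Set.Icc p q →
          (fiber1 X x ∩ Set.Icc p' q').Infinite ∨ (fiber1 X x ∩ Set.Icc p' q').ncard ≤ N

/-- `𝓡 ⊨ LUF₁`: `LUF₂` with `U` always taken to be all of `R^m`. -/
def LUF1 (L : FirstOrder.Language) (R : Type*) [L.Structure R] [LinearOrder R]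
    [TopologicalSpace R] : Prop :=
  ∀ (m : ℕ) (X : Set (Fin (m + 1) → R)), IsDefinable L X → ∀ a : R,
    ∃ N : ℕ, 0 < N ∧ ∃ p q : R, a ∈ interior (Set.Icc p q) ∧
      ∀ (x : Fin m → R), ∀ p' q' : R,
        a ∈ interior (Set.Icc p' q') → Set.Icc p' q' ⊆ Set.Icc p q →
          (fiber1 X x ∩ Set.Icc p' q').Infinite ∨ (fiber1 X x ∩ Set.Icc p' q').ncard ≤ N

/-- `𝓡 ⊨ SLUF`: `LUF₁` with the interval `I` chosen independently of the definable set. -/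
def SLUF (L : FirstOrder.Language) (R : Type*) [L.Structure R] [LinearOrder R]
    [TopologicalSpace R] : Prop :=
  ∀ a : R, ∃ p q : R, a ∈ interior (Set.Icc p q) ∧
    ∀ (m : ℕ) (X : Set (Fin (m + 1) → R)), IsDefinable L X →
      ∃ N : ℕ, 0 < N ∧
        ∀ (x : Fin m → R), ∀ p' q' : R,
          a ∈ interior (Set.Icc p' q') → Set.Icc p' q' ⊆ Set.Icc p q →
            (fiber1 X x ∩ Set.Icc p' q').Infinite ∨ (fiber1 X x ∩ Set.Icc p' q').ncard ≤ N

/-- The language of the open core of `𝓡`: one `n`-ary relation symbol for each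
`𝓡`-definable open subset of `R^n`. -/
def openCoreLang (L : FirstOrder.Language) (R : Type*) [L.Structure R] [TopologicalSpace R] :
    FirstOrder.Language where
  Functions := fun _ => Empty
  Relations := fun n => { s : Set (Fin n → R) // Set.Definable (Set.univ : Set R) L s ∧ IsOpen s }

/-- The open core of `𝓡`: the structure on `R` interpreting each relation symbol by the
corresponding `𝓡`-definable open set. -/
def openCoreStructure (L : FirstOrder.Language) (R : Type*) [L.Structure R]
    [TopologicalSpace R] : (openCoreLang L R).Structure R where
  funMap := fun f _ => f.elim
  RelMap := fun s x => x ∈ s.1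

/-- A set is definable in the open core of `𝓡` if it is definable (with parameters) in the
structure generated by the `𝓡`-definable open sets. -/
def DefinableInOpenCore (L : FirstOrder.Language) (R : Type*) [L.Structure R]
    [TopologicalSpace R] {n : ℕ} (X : Set (Fin n → R)) : Prop :=
  letI := openCoreStructure L R
  Set.Definable (Set.univ : Set R) (openCoreLang L R) X

/-- The local dimension `dim_x X` of `X ⊆ R^n` at `x`, an element of `{-∞} ∪ ℕ ∪ {∞}`:
the supremum of the nonnegative integers `d` such that for every open box `B` containing
`x`, some coordinate projection of `B ∩ X` to `R^d` has nonempty interior (and `-∞` if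
some open box containing `x` misses `X`). -/
noncomputable def locDim {R : Type*} [LT R] [TopologicalSpace R] {n : ℕ}
    (X : Set (Fin n → R)) (x : Fin n → R) : WithBot ℕ∞ :=
  sSup {e : WithBot ℕ∞ | ∃ d : ℕ, e = ((d : ℕ∞) : WithBot ℕ∞) ∧
    ∀ B : Set (Fin n → R), OpenBox B → x ∈ B →
      ∃ f : Fin d → Fin n, Function.Injective f ∧
        (interior ((fun y => y ∘ f) '' (B ∩ X))).Nonempty}

/-- The dimension of `X ⊆ R^n`: the supremum of the local dimensions. -/
noncomputable def setDim {R : Type*} [LT R] [TopologicalSpace R] {n : ℕ}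
    (X : Set (Fin n → R)) : WithBot ℕ∞ :=
  ⨆ x : Fin n → R, locDim X x

/-- The projective dimension of `X ⊆ R^n`: the supremum of the nonnegative integers `d`
such that some coordinate projection of `X` to `R^d` has nonempty interior (`-∞` for the
empty set). -/
noncomputable def projDim {R : Type*} [TopologicalSpace R] {n : ℕ}
    (X : Set (Fin n → R)) : WithBot ℕ∞ :=
  sSup {e : WithBot ℕ∞ | ∃ d : ℕ, e = ((d : ℕ∞) : WithBot ℕ∞) ∧
    ∃ f : Fin d → Fin n, Function.Injective f ∧
      (interior ((fun y => y ∘ f) '' X)).Nonempty}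

/-- A subset of `R` which is a union of at most `N` open intervals. -/
def UnionAtMostOpenIntervals {R : Type*} [Preorder R] (N : ℕ) (s : Set R) : Prop :=
  ∃ Q : Finset (R × R), Q.card ≤ N ∧ s = ⋃ p ∈ Q, Set.Ioo p.1 p.2

/-- A subset of `R` which is a union of at most `N₁` points and `N₂` closed intervals. -/
def UnionAtMostPtsClosedIntervals {R : Type*} [Preorder R] (N₁ N₂ : ℕ) (s : Set R) : Prop :=
  ∃ (P : Finset R) (Q : Finset (R × R)), P.card ≤ N₁ ∧ Q.card ≤ N₂ ∧
    s = ↑P ∪ ⋃ p ∈ Q, Set.Icc p.1 p.2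

/-- A subset of `R` which is a union of at most `N₁` points and `N₂` open intervals. -/
def UnionAtMostPtsOpenIntervals {R : Type*} [Preorder R] (N₁ N₂ : ℕ) (s : Set R) : Prop :=
  ∃ (P : Finset R) (Q : Finset (R × R)), P.card ≤ N₁ ∧ Q.card ≤ N₂ ∧
    s = ↑P ∪ ⋃ p ∈ Q, Set.Ioo p.1 p.2

/-- `X ∩ B` is the graph of a continuous map defined on the coordinate-projection image
of `B` (the projection being given by the injection `f` of coordinates). -/
def IsGraphOn {R : Type*} [TopologicalSpace R] {n d : ℕ} (f : Fin d → Fin n)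
    (S : Set (Fin n → R)) (D : Set (Fin d → R)) : Prop :=
  ∃ g : (Fin d → R) → (Fin n → R), ContinuousOn g D ∧ (∀ z ∈ D, (g z) ∘ f = z) ∧ S = g '' D

end CommonDefs

namespace OC

set_option linter.unusedSectionVars false
set_option linter.unusedVariables false

section Definability

variable {R : Type*} (L : FirstOrder.Language) [L.Structure R]

/-- Definable predicates on tuples. -/
class Df {ι : Type} (P : (ι → R) → Prop) : Prop where
  out : Set.Definable (Set.univ : Set R) L {v | P v}

/-- Definable functions on tuples. -/
class Tm {ι : Type} (t : (ι → R) → R) : Prop where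
  out : Set.DefinableFun L (Set.univ : Set R) t

/-- Definable maps between tuples. -/
class Tv {ι : Type} {n : ℕ} (t : (ι → R) → (Fin n → R)) : Prop where
  out : ∀ k, Set.DefinableFun L (Set.univ : Set R) (fun v => t v k)

/-- The group order is definable. -/
class Hord (R : Type*) (L : FirstOrder.Language) [L.Structure R]
    [LinearOrder R] [AddCommGroup R] : Prop where
  lt : IsDefinable L {v : Fin 2 → R | v 0 < v 1}
  add : IsDefinable L {v : Fin 3 → R | v 0 + v 1 = v 2}

variable {L}
variable {ι : Type}

instance Df.and {P Q : (ι → R) → Prop} [hP : Df L P] [hQ : Df L Q] :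
    Df L (fun v => P v ∧ Q v) := ⟨hP.out.inter hQ.out⟩

instance Df.or {P Q : (ι → R) → Prop} [hP : Df L P] [hQ : Df L Q] :
    Df L (fun v => P v ∨ Q v) := ⟨hP.out.union hQ.out⟩

instance Df.not {P : (ι → R) → Prop} [hP : Df L P] :
    Df L (fun v => ¬ P v) := ⟨hP.out.compl⟩

theorem Df.congr {P Q : (ι → R) → Prop} (hP : Df L P) (h : ∀ v, P v ↔ Q v) : Df L Q := by
  have : P = Q := by funext v; exact propext (h v)
  exact this ▸ hP

instance Df.imp {P Q : (ι → R) → Prop} [hP : Df L P] [hQ : Df L Q] :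
    Df L (fun v => P v → Q v) :=
  Df.congr (P := fun v => ¬ P v ∨ Q v) inferInstance (fun v => by tauto)

instance Df.iff {P Q : (ι → R) → Prop} [hP : Df L P] [hQ : Df L Q] :
    Df L (fun v => P v ↔ Q v) :=
  Df.congr (P := fun v => (P v → Q v) ∧ (Q v → P v)) inferInstance (fun v => by tauto)

instance Df.const (p : Prop) : Df L (fun _ : ι → R => p) := by
  by_cases h : p
  · exact ⟨by simp [h]⟩
  · exact ⟨by simp [h]⟩

instance Df.exV {n : ℕ} {P : (ι → R) → (Fin n → R) → Prop}
    [hP : Df L (fun w : ι ⊕ Fin n → R => P (fun i => w (Sum.inl i)) (fun k => w (Sum.inr k)))] :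
    Df L (fun v => ∃ z : Fin n → R, P v z) :=
  ⟨by simpa using hP.out.exists_of_finite⟩

instance Df.allV {n : ℕ} {P : (ι → R) → (Fin n → R) → Prop}
    [hP : Df L (fun w : ι ⊕ Fin n → R => P (fun i => w (Sum.inl i)) (fun k => w (Sum.inr k)))] :
    Df L (fun v => ∀ z : Fin n → R, P v z) :=
  ⟨by simpa using hP.out.forall_of_finite⟩

instance Df.ex {P : (ι → R) → R → Prop}
    [hP : Df L (fun w : ι ⊕ Unit → R => P (fun i => w (Sum.inl i)) (w (Sum.inr ())))] :
    Df L (fun v => ∃ y : R, P v y) :=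
  Df.congr (P := fun v => ∃ u : Unit → R, P v (u ())) ⟨by simpa using hP.out.exists_of_finite⟩
    (fun v => ⟨fun ⟨u, h⟩ => ⟨_, h⟩, fun ⟨y, h⟩ => ⟨fun _ => y, h⟩⟩)

instance Df.all {P : (ι → R) → R → Prop}
    [hP : Df L (fun w : ι ⊕ Unit → R => P (fun i => w (Sum.inl i)) (w (Sum.inr ())))] :
    Df L (fun v => ∀ y : R, P v y) :=
  Df.congr (P := fun v => ∀ u : Unit → R, P v (u ())) ⟨by simpa using hP.out.forall_of_finite⟩
    (fun v => ⟨fun h y => h (fun _ => y), fun h u => h _⟩)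

instance Df.allFin {n : ℕ} {P : Fin n → (ι → R) → Prop} [hP : ∀ i, Df L (P i)] :
    Df L (fun v => ∀ i, P i v) :=
  ⟨by rw [Set.ofPred_forall]; exact Set.definable_iInter_of_finite fun i => (hP i).out⟩

instance Df.exFin {n : ℕ} {P : Fin n → (ι → R) → Prop} [hP : ∀ i, Df L (P i)] :
    Df L (fun v => ∃ i, P i v) :=
  ⟨by rw [Set.ofPred_exists]; exact Set.definable_iUnion_of_finite fun i => (hP i).out⟩

instance Tm.var (i : ι) : Tm L (fun v : ι → R => v i) := ⟨Set.DefinableFun.proj L⟩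

instance Tm.cst (c : R) : Tm L (fun _ : ι → R => c) :=
  ⟨L.definableFun_const ι (Set.mem_univ c)⟩

instance Tv.cst {n : ℕ} (c : Fin n → R) : Tv L (fun _ : ι → R => c) :=
  ⟨fun k => L.definableFun_const ι (Set.mem_univ (c k))⟩

instance Tv.mk' {n : ℕ} {t : Fin n → (ι → R) → R} [h : ∀ k, Tm L (t k)] :
    Tv L (fun v => fun k => t k v) := ⟨fun k => (h k).out⟩

instance Tv.base {n : ℕ} : Tv L (fun v : Fin n → R => v) := ⟨fun _ => Set.DefinableFun.proj L⟩

instance Tv.snoc {n : ℕ} {t : (ι → R) → (Fin n → R)} {u : (ι → R) → R} [ht : Tv L t]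
    [hu : Tm L u] : Tv L (fun v => (Fin.snoc (t v) (u v) : Fin (n + 1) → R)) := ⟨fun k => by
  induction k using Fin.lastCases with
  | last => simpa using hu.out
  | cast i => simpa using ht.out i⟩

instance Tv.comp {n m : ℕ} {t : (ι → R) → (Fin n → R)} {f : Fin m → Fin n} [ht : Tv L t] :
    Tv L (fun v => t v ∘ f) := ⟨fun k => ht.out (f k)⟩

theorem Tm.ofTv {n : ℕ} {t : (ι → R) → (Fin n → R)} (ht : Tv L t) (k : Fin n) :
    Tm L (fun v => t v k) := ⟨ht.out k⟩

theorem Df.subst {κ : Type} [Finite κ] {P : (κ → R) → Prop} (hP : Df L P)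
    {t : κ → (ι → R) → R} (h : ∀ k, Tm L (t k)) : Df L (fun v => P (fun k => t k v)) :=
  ⟨Set.Definable.preimage_map (F := fun v k => t k v) (fun k => (h k).out) hP.out⟩

theorem Df.substV {n : ℕ} {P : (Fin n → R) → Prop} (hP : Df L P)
    {t : (ι → R) → (Fin n → R)} (h : Tv L t) : Df L (fun v => P (t v)) :=
  ⟨Set.Definable.preimage_map (F := t) (fun k => h.out k) hP.out⟩

instance Df.eq {s t : (ι → R) → R} [hs : Tm L s] [ht : Tm L t] : Df L (fun v => s v = t v) :=
  ⟨hs.out.ofPred_eq ht.out⟩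

instance Df.eqV {n : ℕ} {s t : (ι → R) → (Fin n → R)} [hs : Tv L s] [ht : Tv L t] :
    Df L (fun v => s v = t v) :=
  Df.congr (P := fun v => ∀ k, s v k = t v k)
    (@Df.allFin R L _ ι n (fun k v => s v k = t v k)
      (fun k => @Df.eq R L _ ι _ _ ⟨hs.out k⟩ ⟨ht.out k⟩)) (fun v => funext_iff.symm)

section order
variable [LinearOrder R] [AddCommGroup R] [H : Hord R L]

instance Df.lt {s t : (ι → R) → R} [hs : Tm L s] [ht : Tm L t] : Df L (fun v => s v < t v) :=
  Df.substV (P := fun w : Fin 2 → R => w 0 < w 1) ⟨H.lt⟩ (t := fun v => ![s v, t v])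
    ⟨fun k => by fin_cases k; exacts [hs.out, ht.out]⟩

instance Df.le {s t : (ι → R) → R} [hs : Tm L s] [ht : Tm L t] : Df L (fun v => s v ≤ t v) :=
  Df.congr (P := fun v => ¬ t v < s v) inferInstance (fun v => not_lt)

instance Df.gt {s t : (ι → R) → R} [hs : Tm L s] [ht : Tm L t] : Df L (fun v => s v > t v) :=
  Df.lt

instance Df.memIcc {s t u : (ι → R) → R} [hs : Tm L s] [ht : Tm L t] [hu : Tm L u] :
    Df L (fun v => s v ∈ Set.Icc (t v) (u v)) :=
  Df.congr (P := fun v => t v ≤ s v ∧ s v ≤ u v) inferInstance (fun _ => Iff.rfl)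

instance Df.memIoo {s t u : (ι → R) → R} [hs : Tm L s] [ht : Tm L t] [hu : Tm L u] :
    Df L (fun v => s v ∈ Set.Ioo (t v) (u v)) :=
  Df.congr (P := fun v => t v < s v ∧ s v < u v) inferInstance (fun _ => Iff.rfl)

theorem Tm.of_graph {t : (ι → R) → R}
    (h : Df L (fun w : Option ι → R => t (fun i => w (some i)) = w none)) : Tm L t := ⟨h.out⟩

theorem Tm.weak {κ : Type} {t : (ι → R) → R} (ht : Tm L t) (f : ι → κ) [Finite ι] :
    Tm L (fun w : κ → R => t (fun i => w (f i))) := 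
  ⟨Set.DefinableFun.comp (g := fun (w : κ → R) i => w (f i))
    (fun i => Set.DefinableFun.proj L) ht.out⟩

theorem Tm.comp2 {f : R → R → R} (hf : Tm L (fun w : Fin 2 → R => f (w 0) (w 1)))
    {s t : (ι → R) → R} (hs : Tm L s) (ht : Tm L t) : Tm L (fun v => f (s v) (t v)) :=
  ⟨Set.DefinableFun.comp (g := fun v => ![s v, t v])
    (fun k => by fin_cases k; exacts [hs.out, ht.out]) hf.out⟩

instance Tm.add {s t : (ι → R) → R} [hs : Tm L s] [ht : Tm L t] :
    Tm L (fun v => s v + t v) :=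
  Tm.comp2 (f := fun a b => a + b) (Tm.of_graph
    (Df.substV (P := fun w : Fin 3 → R => w 0 + w 1 = w 2) ⟨H.add⟩
      (t := fun v : Option (Fin 2) → R => ![v (some 0), v (some 1), v none])
      ⟨fun k => by fin_cases k; exacts [Set.DefinableFun.proj L, Set.DefinableFun.proj L, Set.DefinableFun.proj L]⟩)) hs ht

instance Tm.sub {s t : (ι → R) → R} [hs : Tm L s] [ht : Tm L t] :
    Tm L (fun v => s v - t v) :=
  Tm.comp2 (f := fun a b => a - b) (Tm.of_graph
    (Df.congr (P := fun v : Option (Fin 2) → R => v (some 0) = v none + v (some 1)) inferInstance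
      (fun v => by rw [sub_eq_iff_eq_add]))) hs ht

instance Tm.neg {s : (ι → R) → R} [hs : Tm L s] : Tm L (fun v => - s v) := by
  simpa using (inferInstance : Tm L (fun v => 0 - s v))

instance Tm.abs [IsOrderedAddMonoid R] {s : (ι → R) → R} [hs : Tm L s] : Tm L (fun v => |s v|) :=
  Tm.comp2 (f := fun a _ => |a|) (Tm.of_graph
    (Df.congr (P := fun v : Option (Fin 2) → R =>
      (0 ≤ v (some 0) ∧ v none = v (some 0)) ∨ (v (some 0) < 0 ∧ v none = - v (some 0)))
      inferInstance
      (fun v => by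
        rcases le_or_gt 0 (v (some 0)) with h | h
        · simp [h, abs_of_nonneg h, eq_comm, not_lt.2 h]
        · simp [h, abs_of_neg h, eq_comm, not_le.2 h]))) hs hs

end order

/-- definable subset of `R` -/
class D1 (L : FirstOrder.Language) [L.Structure R] (S : Set R) : Prop where
  out : Df L (fun w : Fin 1 → R => w 0 ∈ S)

/-- definable family of subsets of `R` -/
class D11 (L : FirstOrder.Language) [L.Structure R] (A : R → Set R) : Prop where
  out : Df L (fun w : Fin 2 → R => w 1 ∈ A (w 0))

/-- definable family of subsets of `R` -/
class D21 (L : FirstOrder.Language) [L.Structure R] (A : R → R → Set R) : Prop where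
  out : Df L (fun w : Fin 3 → R => w 2 ∈ A (w 0) (w 1))

/-- definable subset of `R^n` -/
class DV (L : FirstOrder.Language) [L.Structure R] {n : ℕ} (S : Set (Fin n → R)) : Prop where
  out : Df L (fun w : Fin n ⊕ Fin 0 → R => (fun i => w (Sum.inl i)) ∈ S)

/-- definable family of subsets of `R^n` -/
class D1V (L : FirstOrder.Language) [L.Structure R] {n : ℕ} (A : R → Set (Fin n → R)) : Prop where
  out : Df L (fun w : Fin n ⊕ Fin 1 → R => (fun i => w (Sum.inl i)) ∈ A (w (Sum.inr 0)))

/-- definable family of subsets of `R^n` -/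
class D2V (L : FirstOrder.Language) [L.Structure R] {n : ℕ} (A : R → R → Set (Fin n → R)) :
    Prop where
  out : Df L (fun w : Fin n ⊕ Fin 2 → R =>
    (fun i => w (Sum.inl i)) ∈ A (w (Sum.inr 0)) (w (Sum.inr 1)))

instance D1.use {S : Set R} [h : D1 L S] {t : (ι → R) → R} [ht : Tm L t] :
    Df L (fun v => t v ∈ S) := h.out.subst (t := fun _ => t) (fun _ => ht)

instance D11.use {A : R → Set R} [h : D11 L A] {t s : (ι → R) → R} [ht : Tm L t] [hs : Tm L s] :
    Df L (fun v => t v ∈ A (s v)) :=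
  h.out.subst (t := ![s, t]) (fun k => by fin_cases k; exacts [hs, ht])

instance D21.use {A : R → R → Set R} [h : D21 L A] {t s r : (ι → R) → R} [ht : Tm L t]
    [hs : Tm L s] [hr : Tm L r] :
    Df L (fun v => t v ∈ A (r v) (s v)) :=
  h.out.subst (t := ![r, s, t]) (fun k => by fin_cases k; exacts [hr, hs, ht])

instance DV.use {n : ℕ} {S : Set (Fin n → R)} [h : DV L S] {t : (ι → R) → (Fin n → R)}
    [ht : Tv L t] : Df L (fun v => t v ∈ S) :=
  h.out.subst (t := Sum.elim (fun i v => t v i) Fin.elim0) (fun k => by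
    rcases k with k | k
    · exact ⟨ht.out k⟩
    · exact k.elim0)

theorem DV.isDef {n : ℕ} {S : Set (Fin n → R)} (h : DV L S) : IsDefinable L S :=
  (DV.use (S := S) (t := fun v : Fin n → R => v)).out

theorem DV.of_isDef {n : ℕ} {S : Set (Fin n → R)} (h : IsDefinable L S) : DV L S :=
  ⟨Df.substV (P := fun w => w ∈ S) ⟨h⟩ inferInstance⟩

theorem D1.isDef {S : Set R} (h : D1 L S) : IsDefinable L {v : Fin 1 → R | v 0 ∈ S} := h.out.out

instance D1V.use {n : ℕ} {A : R → Set (Fin n → R)} [h : D1V L A] {t : (ι → R) → (Fin n → R)}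
    {r : (ι → R) → R} [ht : Tv L t] [hr : Tm L r] :
    Df L (fun v => t v ∈ A (r v)) :=
  h.out.subst (t := Sum.elim (fun i v => t v i) ![r]) (fun k => by
    rcases k with k | k
    · exact ⟨ht.out k⟩
    · fin_cases k; exacts [hr])

instance D2V.use {n : ℕ} {A : R → R → Set (Fin n → R)} [h : D2V L A] {t : (ι → R) → (Fin n → R)}
    {r s : (ι → R) → R} [ht : Tv L t] [hr : Tm L r] [hs : Tm L s] :
    Df L (fun v => t v ∈ A (r v) (s v)) :=
  h.out.subst (t := Sum.elim (fun i v => t v i) ![r, s]) (fun k => by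
    rcases k with k | k
    · exact ⟨ht.out k⟩
    · fin_cases k; exacts [hr, hs])

instance Df.memSetOf {β : Type*} {t : (ι → R) → β} {P : (ι → R) → β → Prop}
    [h : Df L (fun v => P v (t v))] : Df L (fun v => t v ∈ {y | P v y}) := h

instance Df.memInter {β : Type*} {t : (ι → R) → β} {A B : (ι → R) → Set β}
    [h : Df L (fun v => t v ∈ A v)] [h' : Df L (fun v => t v ∈ B v)] :
    Df L (fun v => t v ∈ A v ∩ B v) := Df.and

instance Df.memUnion {β : Type*} {t : (ι → R) → β} {A B : (ι → R) → Set β}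
    [h : Df L (fun v => t v ∈ A v)] [h' : Df L (fun v => t v ∈ B v)] :
    Df L (fun v => t v ∈ A v ∪ B v) := Df.or

instance Df.memCompl {β : Type*} {t : (ι → R) → β} {A : (ι → R) → Set β}
    [h : Df L (fun v => t v ∈ A v)] :
    Df L (fun v => t v ∈ (A v)ᶜ) := Df.not

instance Df.memImage {n m : ℕ} {t : (ι → R) → (Fin m → R)} {f : (Fin n → R) → (Fin m → R)}
    {A : (ι → R) → Set (Fin n → R)} [h : Df L (fun v => ∃ y, y ∈ A v ∧ f y = t v)] :
    Df L (fun v => t v ∈ f '' (A v)) := h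

instance Df.memFiber1 {n : ℕ} {X : (ι → R) → Set (Fin (n + 1) → R)}
    {x : (ι → R) → (Fin n → R)} {t : (ι → R) → R}
    [h : Df L (fun v => (Fin.snoc (x v) (t v) : Fin (n + 1) → R) ∈ X v)] :
    Df L (fun v => t v ∈ fiber1 (X v) (x v)) := h

end Definability

end OC

namespace OC

set_option linter.unusedSectionVars false
set_option linter.unusedVariables false

section CardLE
variable {α : Type*}

/-- at most `N` elements -/
def CardLE (S : Set α) (N : ℕ) : Prop := S.Finite ∧ S.ncard ≤ N

theorem cardLE_iff (S : Set α) (N : ℕ) :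
    CardLE S N ↔ ∀ z : Fin (N + 1) → α, (∀ k, z k ∈ S) → ¬ Function.Injective z := by
  constructor
  · rintro ⟨hf, hc⟩ z hz hi
    have h1 : (Set.range z).ncard ≤ S.ncard :=
      Set.ncard_le_ncard (by rintro _ ⟨k, rfl⟩; exact hz k) hf
    have h2 : (Set.range z).ncard = N + 1 := by
      rw [← Set.image_univ, Set.ncard_image_of_injective _ hi]; simp
    omega
  · intro h
    by_contra hc
    have : ∃ T : Finset α, (T : Set α) ⊆ S ∧ T.card = N + 1 := by
      by_cases hf : S.Finite
      · have : N + 1 ≤ S.ncard := by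
          by_contra h'; exact hc ⟨hf, by omega⟩
        rw [Set.ncard_eq_toFinset_card S hf] at this
        obtain ⟨T, hT, hcard⟩ := Finset.exists_subset_card_eq this
        exact ⟨T, fun x hx => by simpa using hT hx, hcard⟩
      · exact Set.Infinite.exists_subset_card_eq hf (N + 1)
    obtain ⟨T, hT, hcard⟩ := this
    let e := (T.equivFinOfCardEq hcard).symm
    exact h (fun k => (e k : α)) (fun k => hT (e k).2)
      (Subtype.val_injective.comp e.injective)

theorem CardLE.mono {S T : Set α} {N : ℕ} (h : CardLE T N) (hs : S ⊆ T) : CardLE S N :=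
  ⟨h.1.subset hs, (Set.ncard_le_ncard hs h.1).trans h.2⟩

theorem CardLE.mono_right {S : Set α} {N M : ℕ} (h : CardLE S N) (hs : N ≤ M) : CardLE S M :=
  ⟨h.1, h.2.trans hs⟩

theorem exists_rel_max {r : α → α → Prop} (ht : ∀ a b, r a b ∨ r b a)
    (htr : ∀ a b c, r a b → r b c → r a c) :
    ∀ (n : ℕ) (z : Fin (n + 1) → α), ∃ m, ∀ k, r (z k) (z m)
  | 0, z => ⟨0, fun k => by fin_cases k; exact (ht _ _).elim id id⟩
  | n + 1, z => by
    obtain ⟨m, hm⟩ := exists_rel_max ht htr n (fun k => z k.castSucc)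
    rcases ht (z m.castSucc) (z (Fin.last _)) with h | h
    · refine ⟨Fin.last _, fun k => ?_⟩
      induction k using Fin.lastCases with
      | last => exact (ht _ _).elim id id
      | cast i => exact htr _ _ _ (hm i) h
    · refine ⟨m.castSucc, fun k => ?_⟩
      induction k using Fin.lastCases with
      | last => exact h
      | cast i => exact hm i
end CardLE

section Cubes
variable {R : Type*} [LinearOrder R] [AddCommGroup R]

/-- open cube -/
def cube {n : ℕ} (c : Fin n → R) (ε : R) : Set (Fin n → R) := {y | ∀ i, |y i - c i| < ε}

/-- closed cube -/
def ccube {n : ℕ} (c : Fin n → R) (ε : R) : Set (Fin n → R) := {y | ∀ i, |y i - c i| ≤ ε}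

/-- nonempty interior, via cubes -/
def HasInt {n : ℕ} (S : Set (Fin n → R)) : Prop := ∃ c, ∃ ε, 0 < ε ∧ cube c ε ⊆ S

/-- locally finite subsets of the line -/
def LocFin1 (S : Set R) : Prop := ∀ y, ∃ ε, 0 < ε ∧ (S ∩ Icc (y - ε) (y + ε)).Finite

/-- empty interior on the line -/
def NoInt1 (S : Set R) : Prop := ∀ u v, u < v → ∃ y, u < y ∧ y < v ∧ y ∉ S

variable (L : FirstOrder.Language) [L.Structure R] 

/-- the standing assumptions -/
class DL (R : Type*) (L : FirstOrder.Language) [L.Structure R] [LinearOrder R] [AddCommGroup R]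
    [TopologicalSpace R] : Prop extends Hord R L where
  dc : DCProp L R
  luf : LUF2 L R

variable {L} {ι : Type} [Hord R L] [IsOrderedAddMonoid R]

instance Df.memCube {n : ℕ} {t c : (ι → R) → (Fin n → R)} {e : (ι → R) → R} [ht : Tv L t]
    [hc : Tv L c] [he : Tm L e] : Df L (fun v => t v ∈ cube (c v) (e v)) := by
  have := fun i => Tm.ofTv ht i
  have := fun i => Tm.ofTv hc i
  exact (inferInstance : Df L (fun v => ∀ i, |t v i - c v i| < e v))

instance Df.memCcube {n : ℕ} {t c : (ι → R) → (Fin n → R)} {e : (ι → R) → R} [ht : Tv L t]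
    [hc : Tv L c] [he : Tm L e] : Df L (fun v => t v ∈ ccube (c v) (e v)) := by
  have := fun i => Tm.ofTv ht i
  have := fun i => Tm.ofTv hc i
  exact (inferInstance : Df L (fun v => ∀ i, |t v i - c v i| ≤ e v))

theorem HasInt.mono {n : ℕ} {S T : Set (Fin n → R)} (h : HasInt S) (hs : S ⊆ T) : HasInt T := by
  obtain ⟨c, ε, h0, h⟩ := h
  exact ⟨c, ε, h0, h.trans hs⟩

theorem cube_mono {n : ℕ} (c : Fin n → R) {ε δ : R} (h : ε ≤ δ) : cube c ε ⊆ cube c δ :=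
  fun y hy i => (hy i).trans_le h

theorem ccube_mono {n : ℕ} (c : Fin n → R) {ε δ : R} (h : ε ≤ δ) : ccube c ε ⊆ ccube c δ :=
  fun y hy i => (hy i).trans h

theorem cube_sub_ccube {n : ℕ} (c : Fin n → R) (ε : R) : cube c ε ⊆ ccube c ε :=
  fun y hy i => (hy i).le

theorem ccube_sub_cube {n : ℕ} (c : Fin n → R) {ε δ : R} (h : ε < δ) : ccube c ε ⊆ cube c δ :=
  fun y hy i => (hy i).trans_lt h

theorem self_mem_cube {n : ℕ} (c : Fin n → R) {ε : R} (h : 0 < ε) : c ∈ cube c ε :=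
  fun i => by simpa using h

theorem self_mem_ccube {n : ℕ} (c : Fin n → R) {ε : R} (h : 0 ≤ ε) : c ∈ ccube c ε :=
  fun i => by simpa using h

theorem cube_comp {n m : ℕ} (f : Fin m → Fin n) {c y : Fin n → R} {ε : R} (h : y ∈ cube c ε) :
    y ∘ f ∈ cube (c ∘ f) ε := fun i => h (f i)

variable [DenselyOrdered R]

theorem exists_half {s : R} (hs : 0 < s) : ∃ ε, 0 < ε ∧ ε + ε < s := by
  obtain ⟨a, ha, has⟩ := exists_between hs
  obtain ⟨ε, h0, hε⟩ := exists_between (lt_min ha (sub_pos.2 has))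
  refine ⟨ε, h0, ?_⟩
  have h1 := hε.trans_le (min_le_left _ _)
  have h2 := hε.trans_le (min_le_right _ _)
  calc ε + ε < a + (s - a) := add_lt_add h1 h2
    _ = s := by abel

variable [Nontrivial R] [TopologicalSpace R] [OrderTopology R]

theorem isOpen_cube {n : ℕ} (c : Fin n → R) (ε : R) : IsOpen (cube c ε) := by
  have : cube c ε = ⋂ i, (fun y : Fin n → R => y i) ⁻¹' {x | |x - c i| < ε} := by
    ext y; simp [cube]
  rw [this]
  refine isOpen_iInter_of_finite fun i => IsOpen.preimage (continuous_apply i) ?_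
  have : {x | |x - c i| < ε} = Ioo (c i - ε) (c i + ε) := by
    ext x
    simp only [mem_ofPred_eq, abs_lt, mem_Ioo]
    rw [neg_lt_sub_iff_lt_add, sub_lt_iff_lt_add', sub_lt_iff_lt_add, add_comm]
  rw [this]; exact isOpen_Ioo

theorem isClosed_ccube {n : ℕ} (c : Fin n → R) (ε : R) : IsClosed (ccube c ε) := by
  have : ccube c ε = ⋂ i, (fun y : Fin n → R => y i) ⁻¹' {x | |x - c i| ≤ ε} := by
    ext y; simp [ccube]
  rw [this]
  refine isClosed_iInter fun i => IsClosed.preimage (continuous_apply i) ?_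
  have : {x | |x - c i| ≤ ε} = Icc (c i - ε) (c i + ε) := by
    ext x
    simp only [mem_ofPred_eq, abs_le, mem_Icc]
    rw [neg_le_sub_iff_le_add, sub_le_iff_le_add', sub_le_iff_le_add, add_comm]
  rw [this]; exact isClosed_Icc

theorem exists_lt_all {n : ℕ} {e : Fin n → R} (h : ∀ i, 0 < e i) : ∃ ε, 0 < ε ∧ ∀ i, ε < e i := by
  obtain ⟨u, hu⟩ := exists_zero_lt (α := R)
  have : ∃ δ, 0 < δ ∧ ∀ i, δ ≤ e i := by
    induction n with
    | zero => exact ⟨u, hu, fun i => i.elim0⟩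
    | succ n ih =>
      obtain ⟨δ, h0, hd⟩ := ih (e := fun i => e i.castSucc) (fun i => h _)
      refine ⟨min δ (e (Fin.last n)), lt_min h0 (h _), fun i => ?_⟩
      induction i using Fin.lastCases with
      | last => exact min_le_right _ _
      | cast i => exact (min_le_left _ _).trans (hd i)
  obtain ⟨δ, h0, hd⟩ := this
  obtain ⟨ε, h1, h2⟩ := exists_between h0
  exact ⟨ε, h1, fun i => h2.trans_le (hd i)⟩

theorem exists_cube {n : ℕ} {U : Set (Fin n → R)} (hU : IsOpen U) {x : Fin n → R} (hx : x ∈ U) :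
    ∃ ε, 0 < ε ∧ ccube x ε ⊆ U := by
  rw [isOpen_pi_iff'] at hU
  obtain ⟨u, hu, hsub⟩ := hU x hx
  have : ∀ i, ∃ e, 0 < e ∧ {y | |y - x i| < e} ⊆ u i := fun i => by
    have := (nhds_basis_abs_sub_lt (x i)).mem_iff.1 ((hu i).1.mem_nhds (hu i).2)
    simpa using this
  choose e he hs using this
  obtain ⟨ε, h0, hε⟩ := exists_lt_all he
  refine ⟨ε, h0, fun y hy => hsub fun i _ => hs i ?_⟩
  exact (hy i).trans_lt (hε i)

theorem exists_sub_cube {n : ℕ} {c x : Fin n → R} {ε : R} (hx : x ∈ cube c ε) :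
    ∃ δ, 0 < δ ∧ ccube x δ ⊆ cube c ε := exists_cube (isOpen_cube c ε) hx

theorem mem_closure_iff_cube {n : ℕ} {S : Set (Fin n → R)} {x : Fin n → R} :
    x ∈ closure S ↔ ∀ ε, 0 < ε → ∃ y ∈ S, y ∈ cube x ε := by
  rw [mem_closure_iff]
  constructor
  · intro h ε hε
    obtain ⟨y, hy, hy'⟩ := h _ (isOpen_cube x ε) (self_mem_cube x hε)
    exact ⟨y, hy', hy⟩
  · intro h U hU hx
    obtain ⟨ε, h0, hs⟩ := exists_cube hU hx
    obtain ⟨y, hy, hy'⟩ := h ε h0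
    exact ⟨y, hs (cube_sub_ccube _ _ hy'), hy⟩

theorem HasInt.sub_ccube {n : ℕ} {S : Set (Fin n → R)} {c : Fin n → R} {ε : R}
    (h0 : 0 < ε) (h : cube c ε ⊆ S) : ∃ δ, 0 < δ ∧ δ < ε ∧ ccube c δ ⊆ S := by
  obtain ⟨δ, h1, h2⟩ := exists_between h0
  exact ⟨δ, h1, h2, (ccube_sub_cube c h2).trans h⟩

/-- a cube outside a closed set inside an open set not contained in the closed set -/
theorem exists_cube_diff {n : ℕ} {C : Set (Fin n → R)} (hC : IsClosed C) {c : Fin n → R} {ε : R}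
    (h : ¬ cube c ε ⊆ C) : ∃ c' ε', 0 < ε' ∧ ccube c' ε' ⊆ cube c ε ∧ Disjoint (ccube c' ε') C := by
  rw [Set.not_subset] at h
  obtain ⟨x, hx, hxC⟩ := h
  obtain ⟨δ, h0, hs⟩ := exists_cube ((isOpen_cube c ε).inter hC.isOpen_compl) ⟨hx, hxC⟩
  exact ⟨x, δ, h0, fun y hy => (hs hy).1, Set.disjoint_left.2 fun y hy => (hs hy).2⟩

theorem LocFin1.mono {S T : Set R} (h : LocFin1 T) (hs : S ⊆ T) : LocFin1 S := fun y => by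
  obtain ⟨ε, h0, hf⟩ := h y
  exact ⟨ε, h0, hf.subset (by gcongr)⟩

theorem LocFin1.noInt1 {S : Set R} (h : LocFin1 S) : NoInt1 S := by
  intro u v huv
  obtain ⟨m, hum, hmv⟩ := exists_between huv
  obtain ⟨ε, h0, hf⟩ := h m
  by_contra! hc
  have hlt : m < min v (m + ε) := lt_min hmv (lt_add_of_pos_right m h0)
  refine (Set.Ioo_infinite hlt) (hf.subset ?_)
  rintro y ⟨h1, h2⟩
  have h3 := h2.trans_le (min_le_left _ _)
  have h4 := h2.trans_le (min_le_right _ _)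
  exact ⟨hc y (hum.trans h1) h3, by
    constructor
    · exact (sub_lt_self m h0).le.trans h1.le
    · exact h4.le⟩

theorem LocFin1.isClosed {S : Set R} (h : LocFin1 S) : IsClosed S := by
  rw [← isOpen_compl_iff, isOpen_iff_mem_nhds]
  intro y hy
  obtain ⟨ε, h0, hf⟩ := h y
  have h1 : Icc (y - ε) (y + ε) ∈ 𝓝 y :=
    Icc_mem_nhds (sub_lt_self y h0) (lt_add_of_pos_right y h0)
  have h2 : (S ∩ Icc (y - ε) (y + ε))ᶜ ∈ 𝓝 y := hf.isClosed.isOpen_compl.mem_nhds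
    (fun h => hy h.1)
  filter_upwards [h1, h2] with z hz hz' hzS
  exact hz' ⟨hzS, hz⟩

end Cubes

section Line
variable {R : Type*} [LinearOrder R] [AddCommGroup R] [IsOrderedAddMonoid R]
  [DenselyOrdered R] [Nontrivial R] [TopologicalSpace R] [OrderTopology R]
variable {L : FirstOrder.Language} [L.Structure R] [DL R L]

variable (L) in
theorem exists_lub (S : Set R) [D1 L S] (h : S.Nonempty) (hb : BddAbove S) : ∃ a, IsLUB S a :=
  DL.dc (L := L) S (D1.isDef inferInstance) h hb

variable (L) in
theorem exists_glb (S : Set R) [D1 L S] (h : S.Nonempty) (hb : BddBelow S) : ∃ a, IsGLB S a := by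
  have : D1 L {x : R | -x ∈ S} := ⟨inferInstance⟩
  obtain ⟨a, ha⟩ := exists_lub L {x : R | -x ∈ S}
    (by obtain ⟨x, hx⟩ := h; exact ⟨-x, by simpa using hx⟩)
    (by obtain ⟨b, hb⟩ := hb
        exact ⟨-b, fun x hx => by have := hb hx; exact le_neg.1 this⟩)
  refine ⟨-a, fun x hx => ?_, fun b hb => ?_⟩
  · have := ha.1 (show -x ∈ {x : R | -x ∈ S} by simpa using hx)
    exact neg_le.1 this
  · refine le_neg.1 (ha.2 fun x hx => ?_)
    exact le_neg.1 (hb hx)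

variable (L) in
theorem lemmaFin {m : ℕ} (X : Set (Fin (m + 1) → R)) [hX : DV L X] (a : R) (b : Fin m → R) :
    ∃ N : ℕ, ∃ ε, 0 < ε ∧ ∀ x ∈ cube b ε, LocFin1 (fiber1 X x) →
      CardLE (fiber1 X x ∩ Icc (a - ε) (a + ε)) N := by
  obtain ⟨N, hN, p, q, hI, U, hUb, hbU, hU⟩ := DL.luf (L := L) m X (DV.isDef hX) a b
  have hUo : IsOpen U := by
    obtain ⟨c, d, rfl⟩ := hUb
    have : {x : Fin m → R | ∀ i, c i < x i ∧ x i < d i} =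
      Set.pi univ (fun i => Ioo (c i) (d i)) := by ext; simp
    rw [this]; exact isOpen_set_pi finite_univ fun i _ => isOpen_Ioo
  obtain ⟨ε0, h00, hε0⟩ := exists_cube hUo hbU
  rw [interior_Icc] at hI
  obtain ⟨t, ht0, ht⟩ := exists_between (lt_min h00 (lt_min (sub_pos.2 hI.1) (sub_pos.2 hI.2)))
  have ht1 := ht.trans_le (min_le_left _ _)
  have ht2 := (ht.trans_le (min_le_right _ _)).trans_le (min_le_left _ _)
  have ht3 := (ht.trans_le (min_le_right _ _)).trans_le (min_le_right _ _)
  refine ⟨N, t, ht0, fun x hx hL => ?_⟩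
  have hxU : x ∈ U := hε0 (cube_sub_ccube _ _ (cube_mono _ ht1.le hx))
  have key : ∀ u, 0 < u → u ≤ t → (fiber1 X x ∩ Icc (a - u) (a + u)).Finite →
      CardLE (fiber1 X x ∩ Icc (a - u) (a + u)) N := by
    intro u hu hut hf
    rcases hU x hxU (a - u) (a + u) (by rw [interior_Icc]; exact ⟨sub_lt_self a hu, lt_add_of_pos_right a hu⟩)
      (Icc_subset_Icc (by rw [le_sub_comm]; exact hut.trans ht2.le)
        (by rw [← le_sub_iff_add_le']; exact hut.trans ht3.le)) with h | h
    · exact (h hf).elim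
    · exact ⟨hf, h⟩
  let G : Set R := {u | 0 < u ∧ u ≤ t ∧ ∀ z : Fin (N + 1) → R,
    (∀ k, z k ∈ fiber1 X x ∩ Icc (a - u) (a + u)) → ¬ ∀ i j, z i = z j → i = j}
  have : D1 L G := ⟨inferInstance⟩
  have hG : ∀ u, u ∈ G ↔ 0 < u ∧ u ≤ t ∧ (fiber1 X x ∩ Icc (a - u) (a + u)).Finite := by
    intro u
    refine and_congr_right fun h0 => and_congr_right fun h1 => ?_
    have := cardLE_iff (fiber1 X x ∩ Icc (a - u) (a + u)) N
    constructor
    · intro h; exact (this.2 (fun z hz hi => h z hz fun i j hij => hi hij)).1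
    · intro h z hz hi; exact this.1 (key u h0 h1 h) z hz (fun i j hij => hi i j hij)
  obtain ⟨e, he, hef⟩ := hL a
  obtain ⟨τ, hτ⟩ := exists_lub L G
    ⟨min e t, (hG _).2 ⟨lt_min he ht0, min_le_right _ _, hef.subset (by
      gcongr
      · exact min_le_left _ _
      · exact min_le_left _ _)⟩⟩ ⟨t, fun u hu => hu.2.1⟩
  obtain ⟨e1, he1, hf1⟩ := hL (a - τ)
  obtain ⟨e2, he2, hf2⟩ := hL (a + τ)
  obtain ⟨δ, hδ, hδ'⟩ := exists_between (lt_min he1 he2)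
  have hd1 := hδ'.trans_le (min_le_left _ _)
  have hd2 := hδ'.trans_le (min_le_right _ _)
  obtain ⟨g, hg, hgτ⟩ : ∃ g ∈ G, τ - δ < g := by
    by_contra! h
    exact (sub_lt_self τ hδ).not_ge (hτ.2 h)
  have hgG := (hG g).1 hg
  have hgle : g ≤ τ := hτ.1 hg
  have hτ0 : 0 < τ := hgG.1.trans_le hgle
  have hfin : (fiber1 X x ∩ Icc (a - min (τ + δ) t) (a + min (τ + δ) t)).Finite := by
    refine ((hgG.2.2.union hf1).union hf2).subset ?_
    rintro y ⟨hy, h1, h2⟩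
    have h1' : a - (τ + δ) ≤ y := le_trans (sub_le_sub_left (min_le_left _ _) a) h1
    have h2' : y ≤ a + (τ + δ) := le_trans h2 (add_le_add_right (min_le_left _ _) a)
    by_cases c1 : y < a - g
    · refine Or.inl (Or.inr ⟨hy, ?_, ?_⟩)
      · calc a - τ - e1 ≤ a - τ - δ := sub_le_sub_left hd1.le _
          _ = a - (τ + δ) := by abel
          _ ≤ y := h1'
      · calc y ≤ a - g := c1.le
          _ ≤ a - (τ - δ) := sub_le_sub_left hgτ.le _
          _ = a - τ + δ := by abel
          _ ≤ a - τ + e1 := add_le_add_right hd1.le _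
    · by_cases c2 : a + g < y
      · refine Or.inr ⟨hy, ?_, ?_⟩
        · calc a + τ - e2 ≤ a + τ - δ := sub_le_sub_left hd2.le _
            _ = a + (τ - δ) := by abel
            _ ≤ a + g := add_le_add_right hgτ.le _
            _ ≤ y := c2.le
        · calc y ≤ a + (τ + δ) := h2'
            _ = a + τ + δ := by abel
            _ ≤ a + τ + e2 := add_le_add_right hd2.le _
      · exact Or.inl (Or.inl ⟨hy, not_lt.1 c1, not_lt.1 c2⟩)
  have hmin : min (τ + δ) t ≤ τ :=
    hτ.1 ((hG _).2 ⟨lt_min (add_pos hτ0 hδ) ht0, min_le_right _ _, hfin⟩)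
  have : min (τ + δ) t = t := by
    rcases min_le_iff.1 hmin with h | h
    · exact absurd h (lt_add_of_pos_right τ hδ).not_ge
    · exact min_eq_right (h.trans (lt_add_of_pos_right τ hδ).le)
  rw [this] at hfin
  exact key t ht0 le_rfl hfin

end Line
end OC

namespace OC

set_option linter.unusedSectionVars false
set_option linter.unusedVariables false

section Line2
variable {R : Type*} [LinearOrder R] [AddCommGroup R] [IsOrderedAddMonoid R]
  [DenselyOrdered R] [Nontrivial R] [TopologicalSpace R] [OrderTopology R]
variable {L : FirstOrder.Language} [L.Structure R] [DL R L]

theorem IsClosed.lub_mem {C : Set R} (hC : IsClosed C) {S : Set R} (hS : S ⊆ C) (hne : S.Nonempty) {a : R}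
    (h : IsLUB S a) : a ∈ C := hC.closure_subset_iff.2 hS (h.mem_closure hne)

variable (L) in
/-- the largest element of a closed definable set below a point outside it -/
theorem exists_gap (C : Set R) [D1 L C] (hC : IsClosed C) {z y : R} (hz : z ∈ C) (hzy : z < y)
    (hy : y ∉ C) : ∃ e ∈ C, z ≤ e ∧ e < y ∧ ∀ w, e < w → w ≤ y → w ∉ C := by
  have : D1 L {w | w ∈ C ∧ w ≤ y} := ⟨inferInstance⟩
  have hne : {w | w ∈ C ∧ w ≤ y}.Nonempty := ⟨z, hz, hzy.le⟩
  obtain ⟨e, he⟩ := exists_lub L {w | w ∈ C ∧ w ≤ y} hne ⟨y, fun w hw => hw.2⟩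
  have heC : e ∈ C := IsClosed.lub_mem hC (fun w hw => hw.1) hne he
  have hey : e ≤ y := he.2 fun w hw => hw.2
  refine ⟨e, heC, he.1 ⟨hz, hzy.le⟩, lt_of_le_of_ne hey (fun h => hy (h ▸ heC)), ?_⟩
  intro w hw hwy hwC
  exact hw.not_ge (he.1 ⟨hwC, hwy⟩)

theorem locFin1_of_sep {S : Set R} {s : R} (hs : 0 < s)
    (h : ∀ x ∈ S, ∀ y ∈ S, x < y → y < x + s → False) : LocFin1 S := by
  intro y
  obtain ⟨δ, h0, hδ⟩ := exists_half hs
  refine ⟨δ, h0, Set.Subsingleton.finite ?_⟩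
  have key : ∀ u ∈ S ∩ Icc (y - δ) (y + δ), ∀ v ∈ S ∩ Icc (y - δ) (y + δ), ¬ u < v := by
    rintro u ⟨hu, hu1, hu2⟩ v ⟨hv, hv1, hv2⟩ huv
    refine h u hu v hv huv ?_
    calc v ≤ y + δ := hv2
      _ = y - δ + (δ + δ) := by abel
      _ < y - δ + s := add_lt_add_right hδ _
      _ ≤ u + s := add_le_add_left hu1 _
  intro u hu v hv
  exact le_antisymm (not_lt.1 (key v hv u hu)) (not_lt.1 (key u hu v hv))

variable (L) in
theorem lemmaC (C : Set R) [D1 L C] (hC : IsClosed C) (hI : NoInt1 C) : LocFin1 C := by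
  intro a
  let X : Set (Fin (1 + 1) → R) := {w | 0 < w 0 ∧ w 1 ∈ C ∧ ∀ z, w 1 < z → z < w 1 + w 0 → z ∉ C}
  have : DV L X := ⟨inferInstance⟩
  obtain ⟨N, ε, h0, hN⟩ := lemmaFin L X a (fun _ => 0)
  have hfib : ∀ x : Fin 1 → R, fiber1 X x =
      {y | 0 < x 0 ∧ y ∈ C ∧ ∀ z, y < z → z < y + x 0 → z ∉ C} := by
    intro x; ext y
    have e1 : (Fin.snoc x y : Fin (1 + 1) → R) 0 = x 0 := Fin.snoc_castSucc (α := fun _ => R) y x 0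
    have e2 : (Fin.snoc x y : Fin (1 + 1) → R) 1 = y := Fin.snoc_last (α := fun _ => R) y x
    simp only [fiber1, X, mem_ofPred_eq, e1, e2]
  refine ⟨ε, h0, ?_⟩
  suffices CardLE (C ∩ Icc (a - ε) (a + ε)) (N + 1) from this.1
  by_contra hcon
  have : ∃ T : Finset R, (T : Set R) ⊆ C ∩ Icc (a - ε) (a + ε) ∧ T.card = N + 2 := by
    rw [cardLE_iff] at hcon
    push Not at hcon
    obtain ⟨z, hz, hi⟩ := hcon
    refine ⟨Finset.univ.map ⟨z, hi⟩, ?_, by simp⟩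
    intro x hx
    simp at hx
    obtain ⟨k, rfl⟩ := hx
    exact hz k
  obtain ⟨T, hT, hcard⟩ := this
  let z := T.orderEmbOfFin hcard
  have hz : ∀ k, z k ∈ C ∩ Icc (a - ε) (a + ε) := fun k => hT (T.orderEmbOfFin_mem hcard k)
  have hlt : ∀ k : Fin (N + 1), z k.castSucc < z k.succ := fun k =>
    z.strictMono Fin.castSucc_lt_succ
  choose y hy1 hy2 hy3 using fun k => hI _ _ (hlt k)
  choose e heC he1 he2 he3 using fun k => exists_gap L C hC (hz k.castSucc).1 (hy1 k) (hy3 k)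
  obtain ⟨s, hs0, hs⟩ := exists_lt_all (e := fun k => y k - e k) (fun k => sub_pos.2 (he2 k))
  obtain ⟨s', hs'0, hs'⟩ := exists_between (lt_min hs0 h0)
  have hs's := hs'.trans_le (min_le_left _ _)
  have hs'ε := hs'.trans_le (min_le_right _ _)
  have hmem : (fun _ => s') ∈ cube (fun _ : Fin 1 => (0 : R)) ε := fun i => by
    simpa [abs_of_pos hs'0] using hs'ε
  have hloc : LocFin1 (fiber1 X (fun _ => s')) := by
    rw [hfib]
    refine locFin1_of_sep hs'0 ?_
    rintro u ⟨_, hu1, hu2⟩ v ⟨_, hv1, hv2⟩ h1 h2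
    exact hu2 v h1 h2 hv1
  have := (cardLE_iff _ _).1 (hN _ hmem hloc) e ?_
  · refine this ?_
    have hmono : StrictMono e := by
      intro j k hjk
      calc e j < z j.succ := (he2 j).trans (hy2 j)
        _ ≤ z k.castSucc := z.monotone (by
          rw [Fin.le_def]; simp; exact hjk)
        _ ≤ e k := he1 k
    exact hmono.injective
  · intro k
    refine ⟨?_, (hz k.castSucc).2.1.trans (he1 k), ((he2 k).trans (hy2 k)).le.trans (hz k.succ).2.2⟩
    rw [hfib]
    refine ⟨hs'0, heC k, fun w hw hw' => he3 k w hw ?_⟩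
    refine hw'.le.trans ?_
    calc e k + s' ≤ e k + (y k - e k) := add_le_add_right (hs's.trans (hs k)).le _
      _ = y k := by abel

variable (L) in
theorem lemmaChain (A : R → Set R) [D11 L A] (hA : ∀ i, LocFin1 (A i))
    (hch : ∀ i j, A i ⊆ A j ∨ A j ⊆ A i) : LocFin1 {y | ∃ i, y ∈ A i} := by
  intro a
  let X : Set (Fin (1 + 1) → R) := {w | (∃ i, w 0 ∈ A i) ∧ ∀ i, w 0 ∈ A i → w 1 ∈ A i}
  have : DV L X := ⟨inferInstance⟩
  obtain ⟨N, ε, h0, hN⟩ := lemmaFin L X a (fun _ => a)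
  have hfib : ∀ x : Fin 1 → R, fiber1 X x =
      {y | (∃ i, x 0 ∈ A i) ∧ ∀ i, x 0 ∈ A i → y ∈ A i} := by
    intro x; ext y
    have e1 : (Fin.snoc x y : Fin (1 + 1) → R) 0 = x 0 := Fin.snoc_castSucc (α := fun _ => R) y x 0
    have e2 : (Fin.snoc x y : Fin (1 + 1) → R) 1 = y := Fin.snoc_last (α := fun _ => R) y x
    simp only [fiber1, X, mem_ofPred_eq, e1, e2]
  obtain ⟨δ, hδ, hδε⟩ := exists_between h0
  refine ⟨δ, hδ, ?_⟩
  suffices CardLE ({y | ∃ i, y ∈ A i} ∩ Icc (a - δ) (a + δ)) N from this.1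
  rw [cardLE_iff]
  intro z hz hi
  obtain ⟨m, hm⟩ := exists_rel_max (r := fun z z' => ∀ i, z' ∈ A i → z ∈ A i) (by
    intro u v
    by_contra! h
    obtain ⟨⟨i, h1, h2⟩, j, h3, h4⟩ := h
    rcases hch i j with h | h
    · exact h4 (h h1)
    · exact h2 (h h3)) (fun u v w h1 h2 i hi => h1 i (h2 i hi)) N z
  have hmem : (fun _ => z m) ∈ cube (fun _ : Fin 1 => a) ε := fun i => by
    have := (hz m).2
    refine lt_of_le_of_lt (abs_le.2 ⟨?_, ?_⟩) hδε
    · rw [neg_le_sub_iff_le_add]; exact sub_le_iff_le_add.1 this.1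
    · exact sub_le_iff_le_add'.2 this.2
  obtain ⟨i0, hi0⟩ := (hz m).1
  have hloc : LocFin1 (fiber1 X (fun _ => z m)) := by
    rw [hfib]
    exact (hA i0).mono fun y hy => hy.2 i0 hi0
  refine (cardLE_iff _ _).1 (hN _ hmem hloc) z (fun k => ⟨?_, ?_⟩) hi
  · rw [hfib]; exact ⟨⟨i0, hi0⟩, hm k⟩
  · exact Icc_subset_Icc (sub_le_sub_left hδε.le _) (add_le_add_right hδε.le _) (hz k).2

variable (L) in
theorem dich1 (A : R → R → Set R) [D21 L A] (hcl : ∀ r s, 0 < s → IsClosed (A r s))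
    (hmono : ∀ r r' s s', r ≤ r' → 0 < s' → s' ≤ s → A r s ⊆ A r' s')
    (hI : ∀ r s, 0 < s → NoInt1 (A r s)) : LocFin1 {y | ∃ r s, 0 < s ∧ y ∈ A r s} := by
  let B : R → Set R := fun s => {y | 0 < s ∧ ∃ r, y ∈ A r s}
  have hB : ∀ s, LocFin1 (B s) := by
    intro s
    by_cases hs : 0 < s
    · have : D11 L (fun r => A r s) := ⟨inferInstance⟩
      refine (lemmaChain L (fun r => A r s) (fun r => ?_) ?_).mono (fun y hy => hy.2)
      · have : D1 L (A r s) := ⟨inferInstance⟩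
        exact lemmaC L _ (hcl r s hs) (hI r s hs)
      · intro i j
        rcases le_total i j with h | h
        · exact Or.inl (hmono _ _ _ _ h hs le_rfl)
        · exact Or.inr (hmono _ _ _ _ h hs le_rfl)
    · have : B s = ∅ := by ext y; simp [B, hs]
      rw [this]
      exact fun y => ⟨_, exists_zero_lt.choose_spec, by simp⟩
  have : D11 L B := ⟨inferInstance⟩
  refine (lemmaChain L B hB ?_).mono ?_
  · intro i j
    by_cases hi : 0 < i
    · by_cases hj : 0 < j
      · rcases le_total i j with h | h
        · exact Or.inr fun y hy => ⟨hi, hy.2.imp fun r hr => hmono _ _ _ _ le_rfl hi h hr⟩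
        · exact Or.inl fun y hy => ⟨hj, hy.2.imp fun r hr => hmono _ _ _ _ le_rfl hj h hr⟩
      · exact Or.inr fun y hy => absurd hy.1 hj
    · exact Or.inl fun y hy => absurd hy.1 hi
  · rintro y ⟨r, s, hs, hy⟩
    exact ⟨s, hs, r, hy⟩

end Line2
end OC

namespace OC

set_option linter.unusedSectionVars false
set_option linter.unusedVariables false

section Cluster
variable {R : Type*} [LinearOrder R] [AddCommGroup R] [IsOrderedAddMonoid R]
  [DenselyOrdered R] [Nontrivial R] [TopologicalSpace R] [OrderTopology R]
variable {L : FirstOrder.Language} [L.Structure R] [DL R L]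

/-- bounded sets -/
def Bdd {n : ℕ} (S : Set (Fin n → R)) : Prop := ∃ M : R, ∀ y ∈ S, ∀ i, |y i| ≤ M

theorem Bdd.mono {n : ℕ} {S T : Set (Fin n → R)} (h : Bdd T) (hs : S ⊆ T) : Bdd S := by
  obtain ⟨M, hM⟩ := h
  exact ⟨M, fun y hy => hM y (hs hy)⟩

theorem hasInt_iff {n : ℕ} {S : Set (Fin n → R)} :
    HasInt S ↔ ∃ U, IsOpen U ∧ U.Nonempty ∧ U ⊆ S := by
  constructor
  · rintro ⟨c, ε, h0, h⟩
    exact ⟨_, isOpen_cube c ε, ⟨c, self_mem_cube c h0⟩, h⟩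
  · rintro ⟨U, hU, ⟨x, hx⟩, hs⟩
    obtain ⟨ε, h0, h⟩ := exists_cube hU hx
    exact ⟨x, ε, h0, (cube_sub_ccube _ _).trans (h.trans hs)⟩

instance Df.hasInt {ι : Type} {n : ℕ} {S : (ι → R) → Set (Fin n → R)}
    [h : Df L (fun v => ∃ c : Fin n → R, ∃ ε : R, 0 < ε ∧ ∀ y : Fin n → R, y ∈ cube c ε → y ∈ S v)] :
    Df L (fun v => HasInt (S v)) := h.congr fun v => Iff.rfl

theorem HasInt.union_split {n : ℕ} {S T : Set (Fin n → R)} (hS : IsClosed S) (h : HasInt (S ∪ T)) :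
    HasInt S ∨ HasInt T := by
  rw [hasInt_iff] at h
  obtain ⟨U, hU, hne, hs⟩ := h
  by_cases hc : U ⊆ S
  · exact Or.inl (hasInt_iff.2 ⟨U, hU, hne, hc⟩)
  · right
    rw [Set.not_subset] at hc
    obtain ⟨x, hx, hxS⟩ := hc
    exact hasInt_iff.2 ⟨U ∩ Sᶜ, hU.inter hS.isOpen_compl, ⟨x, hx, hxS⟩,
      fun y hy => (hs hy.1).resolve_left hy.2⟩

theorem isClosed_coord {n : ℕ} (p : Fin n → Prop) (x : Fin n → R) (ε : R) :
    IsClosed {y : Fin n → R | ∀ i, p i → |y i - x i| ≤ ε} := by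
  have : {y : Fin n → R | ∀ i, p i → |y i - x i| ≤ ε} =
      ⋂ i, ⋂ (_ : p i), (fun y : Fin n → R => y i) ⁻¹' {z | |z - x i| ≤ ε} := by
    ext y; simp
  rw [this]
  refine isClosed_iInter fun i => isClosed_iInter fun _ => IsClosed.preimage (continuous_apply i) ?_
  have : {z | |z - x i| ≤ ε} = Icc (x i - ε) (x i + ε) := by
    ext z
    simp only [mem_ofPred_eq, abs_le, mem_Icc]
    rw [neg_le_sub_iff_le_add, sub_le_iff_le_add', sub_le_iff_le_add, add_comm]
  rw [this]; exact isClosed_Icc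

/-- largeness notions -/
structure Large (L : FirstOrder.Language) [L.Structure R] {n : ℕ}
    (P : Set (Fin n → R) → Prop) : Prop where
  mono : ∀ S T, S ⊆ T → P S → P T
  empty : ¬ P ∅
  split : ∀ S T, DV L S → DV L T → IsClosed S → IsClosed T → Bdd S → Bdd T → P (S ∪ T) → P S ∨ P T
  df : ∀ (D : R → R → Set (Fin n → R)), D2V L D → Df L (fun w : Fin 2 → R => P (D (w 0) (w 1)))

theorem cluster_aux {n : ℕ} {P : Set (Fin n → R) → Prop} (hP : Large L P)
    (C : R → Set (Fin n → R)) [D1V L C] (hcl : ∀ ε, 0 < ε → IsClosed (C ε)) (M : R)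
    (hM : ∀ ε, 0 < ε → ∀ y ∈ C ε, ∀ i, |y i| ≤ M)
    (hdec : ∀ ε ε', 0 < ε → ε ≤ ε' → C ε ⊆ C ε') (hC : ∀ ε, 0 < ε → P (C ε)) (k : ℕ) (hk : k ≤ n) :
    ∃ x0 : Fin n → R, ∀ ε, 0 < ε → P (C ε ∩ {y | ∀ i, i.val < k → |y i - x0 i| ≤ ε}) := by
  obtain ⟨u, hu⟩ := exists_zero_lt (α := R)
  induction k with
  | zero => exact ⟨fun _ => 0, fun ε hε => by simpa using hC ε hε⟩
  | succ k ih =>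
    obtain ⟨x0, hx0⟩ := ih (by omega)
    let j : Fin n := ⟨k, hk⟩
    let D : R → Set (Fin n → R) := fun ε => C ε ∩ {y | ∀ i, i.val < k → |y i - x0 i| ≤ ε}
    have hD : D1V L D := ⟨inferInstance⟩
    have hDcl : ∀ ε, 0 < ε → IsClosed (D ε) := fun ε hε => (hcl ε hε).inter (isClosed_coord _ _ _)
    have hDdec : ∀ ε ε', 0 < ε → ε ≤ ε' → D ε ⊆ D ε' := fun ε ε' h h' y hy =>
      ⟨hdec ε ε' h h' hy.1, fun i hi => (hy.2 i hi).trans h'⟩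
    have hDM : ∀ ε, 0 < ε → ∀ y ∈ D ε, ∀ i, |y i| ≤ M := fun ε hε y hy => hM ε hε y hy.1
    have hDP : ∀ ε, 0 < ε → P (D ε) := hx0
    have hDs : ∀ ε y, y ∈ D ε → y ∈ C ε ∧ ∀ i : Fin n, i.val < k → |y i - x0 i| ≤ ε :=
      fun _ _ h => h
    clear_value D
    let D2 : R → R → Set (Fin n → R) := fun ε c => D ε ∩ {y | y j ≤ c}
    have h2 : D2V L D2 := ⟨inferInstance⟩
    have h3 := hP.df D2 h2
    have h4 : D2V L (R := R) (n := 0) (fun ε c => {_y | P (D2 ε c)}) :=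
      ⟨Df.subst h3 (t := fun k v => v (Sum.inr k)) (fun k => inferInstance)⟩
    let G : Set R := {c | ∀ ε, 0 < ε → (fun i => i.elim0 : Fin 0 → R) ∈ {_y : Fin 0 → R | P (D2 ε c)}}
    have hG : D1 L G := by
      constructor
      refine @Df.all R L _ _ _ (@Df.imp R L _ _ _ _ _ ?_)
      exact D2V.use (A := (fun ε c => {_y : Fin 0 → R | P (D2 ε c)}))
    have hGmem : ∀ c, c ∈ G ↔ ∀ ε, 0 < ε → P (D2 ε c) := fun c => Iff.rfl
    have hne : M ∈ G := by
      rw [hGmem]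
      intro ε hε
      refine hP.mono (D ε) _ (fun y hy => ⟨hy, ?_⟩) (hDP ε hε)
      exact (le_abs_self _).trans (hDM ε hε y hy j)
    obtain ⟨c, hc⟩ := exists_glb L G ⟨M, hne⟩ ⟨-M, fun c hc => by
      by_contra hlt
      rw [hGmem] at hc
      refine hP.empty (hP.mono _ _ ?_ (hc u hu))
      rintro y ⟨hy, hy'⟩
      have := (abs_le.1 (hDM u hu y hy j)).1
      exact hlt (this.trans hy')⟩
    have key : ∀ ε, 0 < ε → P (D ε ∩ {y | |y j - c| ≤ ε}) := by
      intro ε hε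
      obtain ⟨c', hc', hlt⟩ : ∃ c' ∈ G, c' < c + ε := by
        by_contra! h
        exact (lt_add_of_pos_right c hε).not_ge (hc.2 h)
      have hn : c - ε ∉ G := fun h => (sub_lt_self c hε).not_ge (hc.1 h)
      rw [hGmem] at hn
      push Not at hn
      obtain ⟨ε', hε', hn⟩ := hn
      have hm0 : 0 < min ε ε' := lt_min hε hε'
      have h5 := (hGmem _).1 hc' _ hm0
      rcases hP.split (D (min ε ε') ∩ {y | y j ≤ c - ε}) (D (min ε ε') ∩ {y | c - ε ≤ y j ∧ y j ≤ c'})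
        ⟨inferInstance⟩ ⟨inferInstance⟩ 
        ((hDcl _ hm0).inter (isClosed_le (continuous_apply j) continuous_const))
        ((hDcl _ hm0).inter ((isClosed_le continuous_const (continuous_apply j)).inter 
          (isClosed_le (continuous_apply j) continuous_const)))
        ⟨M, fun y hy => hDM _ hm0 y hy.1⟩ ⟨M, fun y hy => hDM _ hm0 y hy.1⟩
        (hP.mono _ _ (fun y hy => by
          rcases le_total (y j) (c - ε) with h | h
          · exact Or.inl ⟨hy.1, h⟩
          · exact Or.inr ⟨hy.1, h, hy.2⟩) h5) with h | h
      · exact (hn (hP.mono _ _ (fun y hy => ⟨hDdec _ _ hm0 (min_le_right _ _) hy.1, hy.2⟩) h)).elim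
      · refine hP.mono _ _ (fun y hy => ⟨hDdec _ _ hm0 (min_le_left _ _) hy.1, ?_⟩) h
        refine abs_le.2 ⟨?_, ?_⟩
        · have := hy.2.1
          rw [neg_le_sub_iff_le_add]; exact sub_le_iff_le_add.1 this
        · exact sub_le_iff_le_add'.2 (hy.2.2.trans hlt.le)
    refine ⟨Function.update x0 j c, fun ε hε => hP.mono _ _ ?_ (key ε hε)⟩
    rintro y ⟨hy, hyj⟩
    refine ⟨(hDs ε y hy).1, fun i hi => ?_⟩
    by_cases hij : i = j
    · subst hij; simpa using hyj
    · rw [Function.update_of_ne hij]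
      refine (hDs ε y hy).2 i ?_
      have : i.val ≠ k := fun h => hij (Fin.ext h)
      omega

theorem cluster {n : ℕ} {P : Set (Fin n → R) → Prop} (hP : Large L P)
    (C : R → Set (Fin n → R)) [D1V L C] (hcl : ∀ ε, 0 < ε → IsClosed (C ε)) (M : R)
    (hM : ∀ ε, 0 < ε → ∀ y ∈ C ε, ∀ i, |y i| ≤ M)
    (hdec : ∀ ε ε', 0 < ε → ε ≤ ε' → C ε ⊆ C ε') (hC : ∀ ε, 0 < ε → P (C ε)) :
    ∃ x0 : Fin n → R, (∀ ε, 0 < ε → x0 ∈ C ε) ∧ ∀ ε, 0 < ε → P (C ε ∩ ccube x0 ε) := by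
  obtain ⟨x0, h⟩ := cluster_aux hP C hcl M hM hdec hC n le_rfl
  have h' : ∀ ε, 0 < ε → P (C ε ∩ ccube x0 ε) := fun ε hε => by
    convert h ε hε using 2
    ext y; simp [ccube]
  refine ⟨x0, fun ε hε => ?_, h'⟩
  rw [← (hcl ε hε).closure_eq, mem_closure_iff_cube]
  intro δ hδ
  obtain ⟨η, h0, hη⟩ := exists_between (lt_min hε hδ)
  have hne : (C η ∩ ccube x0 η).Nonempty := by
    rw [Set.nonempty_iff_ne_empty]
    intro he
    have := h' η h0
    rw [he] at this
    exact hP.empty this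
  obtain ⟨y, hy, hy'⟩ := hne
  exact ⟨y, hdec _ _ h0 (hη.le.trans (min_le_left _ _)) hy,
    ccube_sub_cube _ (hη.trans_le (min_le_right _ _)) hy'⟩

theorem large_nonempty {n : ℕ} : Large L (fun S : Set (Fin n → R) => S.Nonempty) where
  mono S T h hS := hS.mono h
  empty := by simp
  split S T _ _ _ _ _ _ h := Set.union_nonempty.1 h
  df D hD := (inferInstance : Df L (fun w : Fin 2 → R => ∃ y : Fin n → R, y ∈ D (w 0) (w 1)))

theorem eq_of_mem_ccube {n : ℕ} {x y : Fin n → R} (h : ∀ ε, 0 < ε → x ∈ ccube y ε) : x = y := by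
  funext i
  by_contra hne
  obtain ⟨ε, h0, hε⟩ := exists_between (abs_pos.2 (sub_ne_zero.2 hne))
  exact (hε.trans_le (h ε h0 i)).false

theorem continuous_comp {n m : ℕ} (f : Fin m → Fin n) :
    Continuous (fun y : Fin n → R => y ∘ f) := continuous_pi fun i => continuous_apply (f i)

variable (L) in
theorem isClosed_image {n m : ℕ} (f : Fin m → Fin n) (A : Set (Fin n → R)) [DV L A]
    (hA : IsClosed A) (hb : Bdd A) : IsClosed ((fun y => y ∘ f) '' A) := by
  rw [← closure_subset_iff_isClosed]
  intro x hx
  rw [mem_closure_iff_cube] at hx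
  obtain ⟨M, hM⟩ := hb
  have : D1V L (fun ε => A ∩ {y : Fin n → R | y ∘ f ∈ ccube x ε}) := ⟨inferInstance⟩
  obtain ⟨x0, h0, -⟩ := cluster (large_nonempty (L := L)) (fun ε => A ∩ {y : Fin n → R | y ∘ f ∈ ccube x ε})
    (fun ε _ => hA.inter ((isClosed_ccube x ε).preimage (continuous_comp f))) M
    (fun ε _ y hy => hM y hy.1) (fun ε ε' _ h y hy => ⟨hy.1, ccube_mono _ h hy.2⟩)
    (fun ε hε => by
      obtain ⟨_, ⟨y, hy, rfl⟩, hy'⟩ := hx ε hε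
      exact ⟨y, hy, cube_sub_ccube _ _ hy'⟩)
  obtain ⟨u, hu⟩ := exists_zero_lt (α := R)
  exact ⟨x0, (h0 u hu).1, eq_of_mem_ccube fun ε hε => (h0 ε hε).2⟩

theorem bdd_image {n m : ℕ} (f : Fin m → Fin n) {A : Set (Fin n → R)} (hb : Bdd A) :
    Bdd ((fun y => y ∘ f) '' A) := by
  obtain ⟨M, hM⟩ := hb
  refine ⟨M, ?_⟩
  rintro _ ⟨y, hy, rfl⟩ i
  exact hM y hy (f i)

theorem large_hasInt {n m : ℕ} (f : Fin m → Fin n) :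
    Large L (fun S : Set (Fin n → R) => HasInt ((fun y => y ∘ f) '' S)) where
  mono S T h hS := hS.mono (Set.image_mono h)
  empty := by
    rintro ⟨c, ε, h0, h⟩
    simpa using h (self_mem_cube c h0)
  split S T dS dT hS hT bS bT h := by
    rw [Set.image_union] at h
    exact HasInt.union_split (isClosed_image L f S hS bS) h
  df D hD := inferInstance

/-- families of closed bounded sets -/
structure DSig (L : FirstOrder.Language) [L.Structure R] {n : ℕ}
    (A : R → R → Set (Fin n → R)) : Prop where
  d : D2V L A
  cl : ∀ r s, 0 < s → IsClosed (A r s)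
  bd : ∀ r s, 0 < s → Bdd (A r s)
  mono : ∀ r r' s s', r ≤ r' → 0 < s' → s' ≤ s → A r s ⊆ A r' s'

/-- the union of a family -/
def Un {n : ℕ} (A : R → R → Set (Fin n → R)) : Set (Fin n → R) := {y | ∃ r s, 0 < s ∧ y ∈ A r s}

instance DV.un {n : ℕ} {A : R → R → Set (Fin n → R)} [D2V L A] : DV L (Un A) :=
  ⟨(inferInstance : Df L (fun w : Fin n ⊕ Fin 0 → R => ∃ r s, 0 < s ∧ (fun i => w (Sum.inl i)) ∈ A r s))⟩

variable (L) in
/-- `D_Σ` sets -/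
def IsDS {n : ℕ} (X : Set (Fin n → R)) : Prop := ∃ A : R → R → Set (Fin n → R), DSig L A ∧ X = Un A

theorem DSig.dv {n : ℕ} {A : R → R → Set (Fin n → R)} (h : DSig L A) : DV L (Un A) := by
  have := h.d
  infer_instance

theorem IsDS.dv {n : ℕ} {X : Set (Fin n → R)} (h : IsDS L X) : DV L X := by
  obtain ⟨A, hA, rfl⟩ := h
  exact hA.dv

theorem DSig.interC {n : ℕ} {A : R → R → Set (Fin n → R)} (h : DSig L A) (C : Set (Fin n → R))
    [DV L C] (hC : IsClosed C) : DSig L (fun r s => A r s ∩ C) where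
  d := by have := h.d; exact ⟨inferInstance⟩
  cl r s hs := (h.cl r s hs).inter hC
  bd r s hs := (h.bd r s hs).mono inter_subset_left
  mono r r' s s' h1 h2 h3 := inter_subset_inter_left _ (h.mono r r' s s' h1 h2 h3)

theorem un_interC {n : ℕ} (A : R → R → Set (Fin n → R)) (C : Set (Fin n → R)) :
    Un (fun r s => A r s ∩ C) = Un A ∩ C := by
  ext y; simp only [Un, mem_ofPred_eq, mem_inter_iff]; tauto

theorem DSig.inter {n : ℕ} {A B : R → R → Set (Fin n → R)} (h : DSig L A) (h' : DSig L B) :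
    DSig L (fun r s => A r s ∩ B r s) where
  d := by have := h.d; have := h'.d; exact ⟨inferInstance⟩
  cl r s hs := (h.cl r s hs).inter (h'.cl r s hs)
  bd r s hs := (h.bd r s hs).mono inter_subset_left
  mono r r' s s' h1 h2 h3 := inter_subset_inter (h.mono r r' s s' h1 h2 h3) (h'.mono r r' s s' h1 h2 h3)

theorem DSig.max_mem {n : ℕ} {A : R → R → Set (Fin n → R)} (h : DSig L A) {r s : R} (r' : R) {s' : R}
    (hs : 0 < s) (hs' : 0 < s') : A r s ⊆ A (max r r') (min s s') :=
  h.mono _ _ _ _ (le_max_left _ _) (lt_min hs hs') (min_le_left _ _)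

theorem DSig.max_mem' {n : ℕ} {A : R → R → Set (Fin n → R)} (h : DSig L A) {r s : R} (r' : R) {s' : R}
    (hs : 0 < s) (hs' : 0 < s') : A r s ⊆ A (max r' r) (min s' s) :=
  h.mono _ _ _ _ (le_max_right _ _) (lt_min hs' hs) (min_le_right _ _)

theorem DSig.un_inter {n : ℕ} {A B : R → R → Set (Fin n → R)} (h : DSig L A) (h' : DSig L B) :
    Un (fun r s => A r s ∩ B r s) = Un A ∩ Un B := by
  ext y
  constructor
  · rintro ⟨r, s, hs, h1, h2⟩
    exact ⟨⟨r, s, hs, h1⟩, ⟨r, s, hs, h2⟩⟩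
  · rintro ⟨⟨r, s, hs, h1⟩, ⟨r', s', hs', h2⟩⟩
    exact ⟨max r r', min s s', lt_min hs hs', h.max_mem r' hs hs' h1, h'.max_mem' r hs' hs h2⟩

theorem Bdd.union {n : ℕ} {S T : Set (Fin n → R)} (h : Bdd S) (h' : Bdd T) : Bdd (S ∪ T) := by
  obtain ⟨M, hM⟩ := h
  obtain ⟨M', hM'⟩ := h'
  refine ⟨max M M', ?_⟩
  rintro y (hy | hy) i
  · exact (hM y hy i).trans (le_max_left _ _)
  · exact (hM' y hy i).trans (le_max_right _ _)

theorem DSig.union {n : ℕ} {A B : R → R → Set (Fin n → R)} (h : DSig L A) (h' : DSig L B) :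
    DSig L (fun r s => A r s ∪ B r s) where
  d := by have := h.d; have := h'.d; exact ⟨inferInstance⟩
  cl r s hs := (h.cl r s hs).union (h'.cl r s hs)
  bd r s hs := (h.bd r s hs).union (h'.bd r s hs)
  mono r r' s s' h1 h2 h3 := union_subset_union (h.mono r r' s s' h1 h2 h3) (h'.mono r r' s s' h1 h2 h3)

theorem un_union {n : ℕ} (A B : R → R → Set (Fin n → R)) :
    Un (fun r s => A r s ∪ B r s) = Un A ∪ Un B := by
  ext y
  constructor
  · rintro ⟨r, s, hs, h1 | h2⟩
    · exact Or.inl ⟨r, s, hs, h1⟩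
    · exact Or.inr ⟨r, s, hs, h2⟩
  · rintro (⟨r, s, hs, h⟩ | ⟨r, s, hs, h⟩)
    · exact ⟨r, s, hs, Or.inl h⟩
    · exact ⟨r, s, hs, Or.inr h⟩

theorem DSig.image {n m : ℕ} (f : Fin m → Fin n) {A : R → R → Set (Fin n → R)} (h : DSig L A) :
    DSig L (fun r s => (fun y => y ∘ f) '' A r s) where
  d := by have := h.d; exact ⟨inferInstance⟩
  cl r s hs := by
    have := h.d
    have : DV L (A r s) := ⟨inferInstance⟩
    exact isClosed_image L f _ (h.cl r s hs) (h.bd r s hs)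
  bd r s hs := bdd_image f (h.bd r s hs)
  mono r r' s s' h1 h2 h3 := image_mono (h.mono r r' s s' h1 h2 h3)

theorem un_image {n m : ℕ} (f : (Fin n → R) → (Fin m → R)) (A : R → R → Set (Fin n → R)) :
    Un (fun r s => f '' A r s) = f '' Un A := by
  ext x
  constructor
  · rintro ⟨r, s, hs, y, hy, rfl⟩
    exact ⟨y, ⟨r, s, hs, hy⟩, rfl⟩
  · rintro ⟨y, ⟨r, s, hs, hy⟩, rfl⟩
    exact ⟨r, s, hs, y, hy, rfl⟩

theorem bdd_ccube {n : ℕ} (r : R) : Bdd (ccube (0 : Fin n → R) r) :=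
  ⟨r, fun y hy i => by simpa using hy i⟩

theorem exists_bound {n : ℕ} (y : Fin n → R) : ∃ r, y ∈ ccube 0 r := by
  induction n with
  | zero => exact ⟨0, fun i => i.elim0⟩
  | succ n ih =>
    obtain ⟨r, hr⟩ := ih (y ∘ Fin.castSucc)
    refine ⟨max r |y (Fin.last n)|, fun i => ?_⟩
    induction i using Fin.lastCases with
    | last => simp
    | cast i => exact (hr i).trans (le_max_left _ _)

theorem dsig_closed {n : ℕ} (C : Set (Fin n → R)) [DV L C] (hC : IsClosed C) :
    DSig L (fun r s => C ∩ ccube 0 r) where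
  d := ⟨inferInstance⟩
  cl r s hs := hC.inter (isClosed_ccube _ _)
  bd r s hs := (bdd_ccube r).mono inter_subset_right
  mono r r' s s' h1 h2 h3 := inter_subset_inter_right _ (ccube_mono _ h1)

variable (L) in
theorem isDS_closed {n : ℕ} (C : Set (Fin n → R)) [DV L C] (hC : IsClosed C) : IsDS L C := by
  refine ⟨_, dsig_closed C hC, ?_⟩
  obtain ⟨u, hu⟩ := exists_zero_lt (α := R)
  ext y
  constructor
  · intro hy
    obtain ⟨r, hr⟩ := exists_bound y
    exact ⟨r, u, hu, hy, hr⟩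
  · rintro ⟨r, s, hs, h, _⟩
    exact h

variable (L) in
theorem isDS_open {n : ℕ} (U : Set (Fin n → R)) [DV L U] (hU : IsOpen U) : IsDS L U := by
  have hd : D2V L (fun r s => {y : Fin n → R | y ∈ ccube 0 r ∧ ∀ z : Fin n → R, y ∈ cube z s → z ∈ U}) :=
    ⟨inferInstance⟩
  refine ⟨_, ⟨hd, ?_, ?_, ?_⟩, ?_⟩
  · intro r s hs
    refine (isClosed_ccube _ _).inter ?_
    have : {y : Fin n → R | ∀ z, y ∈ cube z s → z ∈ U} = ⋂ z, ⋂ (_ : z ∉ U), (cube z s)ᶜ := by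
      ext y; simp only [mem_iInter, mem_compl_iff, mem_ofPred_eq]
      exact forall_congr' fun z => by tauto
    change IsClosed {y : Fin n → R | ∀ z, y ∈ cube z s → z ∈ U}
    rw [this]
    exact isClosed_iInter fun z => isClosed_iInter fun _ => (isOpen_cube z s).isClosed_compl
  · intro r s hs
    exact (bdd_ccube r).mono fun y hy => hy.1
  · intro r r' s s' h1 h2 h3 y hy
    exact ⟨ccube_mono _ h1 hy.1, fun z hz => hy.2 z (cube_mono _ h3 hz)⟩
  · ext y
    constructor
    · intro hy
      obtain ⟨r, hr⟩ := exists_bound y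
      obtain ⟨s, hs, h⟩ := exists_cube hU hy
      refine ⟨r, s, hs, hr, fun z hz => h fun i => ?_⟩
      rw [abs_sub_comm]; exact (hz i).le
    · rintro ⟨r, s, hs, _, h⟩
      exact h y (self_mem_cube _ hs)

theorem IsDS.inter {n : ℕ} {X Y : Set (Fin n → R)} (h : IsDS L X) (h' : IsDS L Y) :
    IsDS L (X ∩ Y) := by
  obtain ⟨A, hA, rfl⟩ := h
  obtain ⟨B, hB, rfl⟩ := h'
  exact ⟨_, hA.inter hB, (hA.un_inter hB).symm⟩

theorem IsDS.union {n : ℕ} {X Y : Set (Fin n → R)} (h : IsDS L X) (h' : IsDS L Y) :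
    IsDS L (X ∪ Y) := by
  obtain ⟨A, hA, rfl⟩ := h
  obtain ⟨B, hB, rfl⟩ := h'
  exact ⟨_, hA.union hB, (un_union A B).symm⟩

theorem IsDS.image {n m : ℕ} (f : Fin m → Fin n) {X : Set (Fin n → R)} (h : IsDS L X) :
    IsDS L ((fun y => y ∘ f) '' X) := by
  obtain ⟨A, hA, rfl⟩ := h
  exact ⟨_, hA.image f, (un_image _ A).symm⟩

end Cluster
end OC

namespace OC

set_option linter.unusedSectionVars false
set_option linter.unusedVariables false

section TStep
variable {R : Type*} [LinearOrder R] [AddCommGroup R] [IsOrderedAddMonoid R]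
  [DenselyOrdered R] [Nontrivial R] [TopologicalSpace R] [OrderTopology R]
variable {L : FirstOrder.Language} [L.Structure R] [DL R L]

/-- points over which the fiber contains a segment of length `s`, with the start of the segment -/
def CT {n : ℕ} (C : Set (Fin (n + 1) → R)) (s : R) : Set (Fin (n + 1) → R) :=
  {w | ∀ z, w (Fin.last n) ≤ z → z ≤ w (Fin.last n) + s →
    (Fin.snoc (w ∘ Fin.castSucc) z : Fin (n + 1) → R) ∈ C}

theorem snoc_comp {n : ℕ} (w : Fin (n + 1) → R) :
    (Fin.snoc (w ∘ Fin.castSucc) (w (Fin.last n)) : Fin (n + 1) → R) = w :=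
  Fin.snoc_init_self w

theorem snoc_comp' {n : ℕ} (x : Fin n → R) (z : R) :
    (Fin.snoc x z : Fin (n + 1) → R) ∘ Fin.castSucc = x := by
  funext i; simp

theorem snoc_last' {n : ℕ} (x : Fin n → R) (z : R) :
    (Fin.snoc x z : Fin (n + 1) → R) (Fin.last n) = z := by simp

theorem isClosed_CT {n : ℕ} {C : Set (Fin (n + 1) → R)} (hC : IsClosed C) (s : R) :
    IsClosed (CT C s) := by
  have : CT C s = ⋂ t, ⋂ (_ : 0 ≤ t ∧ t ≤ s), (fun w : Fin (n + 1) → R =>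
      (Fin.snoc (w ∘ Fin.castSucc) (w (Fin.last n) + t) : Fin (n + 1) → R)) ⁻¹' C := by
    ext w
    simp only [CT, mem_iInter, mem_preimage, mem_ofPred_eq]
    constructor
    · rintro h t ⟨h0, hs⟩
      exact h _ (le_add_of_nonneg_right h0) (add_le_add_right hs _)
    · intro h z h1 h2
      have := h (z - w (Fin.last n)) ⟨sub_nonneg.2 h1, sub_le_iff_le_add'.2 h2⟩
      simpa using this
  rw [this]
  refine isClosed_iInter fun t => isClosed_iInter fun _ => hC.preimage ?_
  refine continuous_pi fun i => ?_
  induction i using Fin.lastCases with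
  | last =>
    simp only [Fin.snoc_last]
    exact (continuous_apply (Fin.last n)).add continuous_const
  | cast i => simpa using continuous_apply (i.castSucc)

theorem CT_subset {n : ℕ} {C : Set (Fin (n + 1) → R)} {s : R} (hs : 0 < s) : CT C s ⊆ C := by
  intro w hw
  have := hw (w (Fin.last n)) le_rfl (le_add_of_nonneg_right hs.le)
  rwa [snoc_comp] at this

theorem hasInt_prod {n : ℕ} {C : Set (Fin (n + 1) → R)} {V : Set (Fin n → R)} (hV : IsOpen V)
    (hne : V.Nonempty) {u v : R} (huv : u < v)
    (h : ∀ x ∈ V, ∀ z, u < z → z < v → (Fin.snoc x z : Fin (n + 1) → R) ∈ C) : HasInt C := by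
  obtain ⟨x, hx⟩ := hne
  obtain ⟨z, hz1, hz2⟩ := exists_between huv
  refine hasInt_iff.2 ⟨{w | w ∘ Fin.castSucc ∈ V ∧ u < w (Fin.last n) ∧ w (Fin.last n) < v},
    ?_, ⟨Fin.snoc x z, ?_⟩, ?_⟩
  · refine (hV.preimage (continuous_comp Fin.castSucc)).inter (IsOpen.inter ?_ ?_)
    · exact isOpen_lt continuous_const (continuous_apply _)
    · exact isOpen_lt (continuous_apply _) continuous_const
  · refine ⟨?_, ?_, ?_⟩
    · rw [snoc_comp']; exact hx
    · rwa [snoc_last']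
    · rwa [snoc_last']
  · rintro w ⟨h1, h2, h3⟩
    have := h _ h1 _ h2 h3
    rwa [snoc_comp] at this

variable (L) in
theorem hasInt_of_T {n : ℕ} (C : Set (Fin (n + 1) → R)) [DV L C] (hC : IsClosed C) (hb : Bdd C)
    {s : R} (hs : 0 < s) (hT : HasInt ((fun y => y ∘ Fin.castSucc) '' CT C s)) : HasInt C := by
  have hd : DV L (CT C s) := ⟨(inferInstance : Df L (fun w : Fin (n + 1) ⊕ Fin 0 → R =>
    (∀ z, w (Sum.inl (Fin.last n)) ≤ z → z ≤ w (Sum.inl (Fin.last n)) + s →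
    (Fin.snoc ((fun i => w (Sum.inl i)) ∘ Fin.castSucc) z : Fin (n + 1) → R) ∈ C)))⟩
  have hcl := isClosed_CT hC s
  have hCb : Bdd (CT C s) := hb.mono (CT_subset hs)
  let F : R → Set (Fin n → R) := fun c => (fun y => y ∘ Fin.castSucc) '' (CT C s ∩ {w | w (Fin.last n) ≤ c})
  have hFcl : ∀ c, IsClosed (F c) := fun c => by
    have : DV L (CT C s ∩ {w | w (Fin.last n) ≤ c}) := ⟨inferInstance⟩
    exact isClosed_image L _ _ (hcl.inter (isClosed_le (continuous_apply _) continuous_const))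
      (hCb.mono inter_subset_left)
  have hF : D1V L F := ⟨inferInstance⟩
  let G : Set R := {c | HasInt (F c)}
  have hG : D1 L G := ⟨inferInstance⟩
  obtain ⟨M, hM⟩ := hCb
  obtain ⟨c, hc⟩ := exists_glb L G ⟨M, hT.mono (by
      rintro _ ⟨w, hw, rfl⟩
      exact ⟨w, ⟨hw, (le_abs_self _).trans (hM w hw _)⟩, rfl⟩)⟩ ⟨-M, by
      rintro c ⟨p, δ, h0, hp⟩
      obtain ⟨w, ⟨hw, hw'⟩, -⟩ := hp (self_mem_cube p h0)
      exact (abs_le.1 (hM w hw (Fin.last n))).1.trans hw'⟩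
  obtain ⟨ε, h0, hε⟩ := exists_half hs
  obtain ⟨c', hc', hlt⟩ : ∃ c' ∈ G, c' < c + ε := by
    by_contra! h
    exact (lt_add_of_pos_right c h0).not_ge (hc.2 h)
  have hn : ¬ HasInt (F (c - ε)) := fun h => (sub_lt_self c h0).not_ge (hc.1 h)
  obtain ⟨U, hU, hUne, hUs⟩ := hasInt_iff.1 hc'
  have hns : ¬ U ⊆ F (c - ε) := fun h => hn (hasInt_iff.2 ⟨U, hU, hUne, h⟩)
  rw [Set.not_subset] at hns
  obtain ⟨p, hp, hp'⟩ := hns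
  refine hasInt_prod (hU.inter (hFcl (c - ε)).isOpen_compl) ⟨p, hp, hp'⟩ (u := c + ε) (v := c - ε + s) ?_ ?_
  · calc c + ε = c - ε + (ε + ε) := by abel
      _ < c - ε + s := add_lt_add_right hε _
  · rintro x ⟨hx, hx'⟩ z hz1 hz2
    obtain ⟨w, ⟨hw, hwc⟩, rfl⟩ := hUs hx
    have h1 : c - ε < w (Fin.last n) := by
      by_contra hle
      exact hx' ⟨w, ⟨hw, not_lt.1 hle⟩, rfl⟩
    refine hw z ?_ ?_
    · exact (le_trans hwc hlt.le).trans hz1.le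
    · exact hz2.le.trans (add_le_add_left h1.le _)

/-- the family of segment sets -/
def TF {n : ℕ} (A : R → R → Set (Fin (n + 1) → R)) : R → R → Set (Fin n → R) :=
  fun r s => (fun y => y ∘ Fin.castSucc) '' CT (A r s) s

theorem DSig.ct {n : ℕ} {A : R → R → Set (Fin (n + 1) → R)} (h : DSig L A) :
    DSig L (fun r s => CT (A r s) s) where
  d := by
    have := h.d
    exact ⟨(inferInstance : Df L (fun w : Fin (n + 1) ⊕ Fin 2 → R =>
      (∀ z, w (Sum.inl (Fin.last n)) ≤ z → z ≤ w (Sum.inl (Fin.last n)) + w (Sum.inr 1) →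
      (Fin.snoc ((fun i => w (Sum.inl i)) ∘ Fin.castSucc) z : Fin (n + 1) → R) ∈ A (w (Sum.inr 0)) (w (Sum.inr 1)))))⟩
  cl r s hs := isClosed_CT (h.cl r s hs) s
  bd r s hs := (h.bd r s hs).mono (CT_subset hs)
  mono r r' s s' h1 h2 h3 := fun w hw z hz1 hz2 =>
    h.mono r r' s s' h1 h2 h3 (hw z hz1 (hz2.trans (add_le_add_right h3 _)))

theorem DSig.tf {n : ℕ} {A : R → R → Set (Fin (n + 1) → R)} (h : DSig L A) : DSig L (TF A) :=
  h.ct.image Fin.castSucc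

theorem DSig.hasInt_of_tf {n : ℕ} {A : R → R → Set (Fin (n + 1) → R)} (h : DSig L A) {r s : R}
    (hs : 0 < s) (hT : HasInt (TF A r s)) : HasInt (A r s) := by
  have := h.d
  have : DV L (A r s) := ⟨inferInstance⟩
  exact hasInt_of_T L _ (h.cl r s hs) (h.bd r s hs) hs hT

theorem continuous_snoc {n : ℕ} (x : Fin n → R) :
    Continuous (fun z : R => (Fin.snoc x z : Fin (n + 1) → R)) := by
  refine continuous_pi fun i => ?_
  induction i using Fin.lastCases with
  | last =>
    simp only [Fin.snoc_last]
    exact continuous_id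
  | cast i => simpa using continuous_const

theorem DSig.locFin1_fiber {n : ℕ} {A : R → R → Set (Fin (n + 1) → R)} (h : DSig L A) {x : Fin n → R}
    (hx : x ∉ Un (TF A)) : LocFin1 (fiber1 (Un A) x) := by
  have := h.d
  have : D21 L (fun r s => fiber1 (A r s) x) := ⟨inferInstance⟩
  refine dich1 L (fun r s => fiber1 (A r s) x)
    (fun r s hs => (h.cl r s hs).preimage (continuous_snoc x))
    (fun r r' s s' h1 h2 h3 z hz => h.mono r r' s s' h1 h2 h3 hz) ?_
  intro r s hs
  by_contra hI
  unfold NoInt1 at hI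
  push Not at hI
  obtain ⟨u, v, huv, hI⟩ := hI
  obtain ⟨y, hy1, hy2⟩ := exists_between huv
  obtain ⟨t, ht0, ht⟩ := exists_between (lt_min hs (sub_pos.2 hy2))
  refine hx ⟨r, t, ht0, Fin.snoc x y, ?_, snoc_comp' x y⟩
  intro z hz1 hz2
  rw [snoc_comp']
  rw [snoc_last'] at hz1 hz2
  refine h.mono r r s t le_rfl ht0 (ht.le.trans (min_le_left _ _)) (hI z (hy1.trans_le hz1) ?_)
  calc z ≤ y + t := hz2
    _ < y + (v - y) := add_lt_add_right (ht.trans_le (min_le_right _ _)) _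
    _ = v := by abel

theorem baire : ∀ {n : ℕ} {A : R → R → Set (Fin n → R)}, DSig L A → HasInt (Un A) →
    ∃ r s, 0 < s ∧ HasInt (A r s)
  | 0, A, h, hI => by
    obtain ⟨c, ε, h0, hc⟩ := hI
    obtain ⟨r, s, hs, hr⟩ := hc (self_mem_cube c h0)
    exact ⟨r, s, hs, c, ε, h0, fun y _ => by rwa [Subsingleton.elim y c]⟩
  | n + 1, A, h, hI => by
    obtain ⟨c, ε, h0, hc⟩ := hI
    have : HasInt (Un (TF A)) := by
      refine ⟨c ∘ Fin.castSucc, ε, h0, fun x hx => ?_⟩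
      by_contra hxT
      have := (h.locFin1_fiber hxT).noInt1 (c (Fin.last n) - ε) (c (Fin.last n) + ε)
        ((sub_lt_self _ h0).trans (lt_add_of_pos_right _ h0))
      obtain ⟨y, hy1, hy2, hy⟩ := this
      refine hy (hc fun i => ?_)
      induction i using Fin.lastCases with
      | last =>
        rw [snoc_last', abs_lt]
        constructor
        · rw [neg_lt_sub_iff_lt_add]; exact sub_lt_iff_lt_add'.1 hy1
        · exact sub_lt_iff_lt_add'.2 hy2
      | cast i => simpa using hx i
    obtain ⟨r, s, hs, hT⟩ := baire h.tf this
    exact ⟨r, s, hs, h.hasInt_of_tf hs hT⟩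

theorem exists_max_nat {P : ℕ → Prop} (h0 : P 0) {N : ℕ} (hN : ∀ k, P k → k ≤ N) :
    ∃ k, P k ∧ ¬ P (k + 1) := by
  by_contra! h
  have : ∀ k, P k := fun k => Nat.rec h0 (fun k hk => h k hk) k
  have := hN _ (this (N + 1))
  omega

/-- nowhere-dense dichotomy -/
theorem nd : ∀ {n : ℕ} {A : R → R → Set (Fin n → R)}, DSig L A → ∀ {U : Set (Fin n → R)}, IsOpen U →
    U.Nonempty → ∃ V, IsOpen V ∧ V.Nonempty ∧ V ⊆ U ∧
      ((∃ r s, 0 < s ∧ V ⊆ A r s) ∨ Disjoint V (Un A))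
  | 0, A, h, U, hU, ⟨x, hx⟩ => by
    refine ⟨U, hU, ⟨x, hx⟩, le_rfl, ?_⟩
    by_cases hxA : x ∈ Un A
    · obtain ⟨r, s, hs, hr⟩ := hxA
      exact Or.inl ⟨r, s, hs, fun y _ => by rwa [Subsingleton.elim y x]⟩
    · refine Or.inr (Set.disjoint_left.2 fun y _ => ?_)
      rwa [Subsingleton.elim y x]
  | n + 1, A, h, U, hU, ⟨c, hc⟩ => by
    obtain ⟨δ, hδ, hδU⟩ := exists_cube hU hc
    have hcc : DV L (ccube c δ) := ⟨inferInstance⟩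
    let A' : R → R → Set (Fin (n + 1) → R) := fun r s => A r s ∩ ccube c δ
    have hA' : DSig L A' := h.interC _ (isClosed_ccube c δ)
    have hUA' : Un A' = Un A ∩ ccube c δ := un_interC _ _
    by_cases hI : ∃ r s, 0 < s ∧ HasInt (A' r s)
    · obtain ⟨r, s, hs, hI⟩ := hI
      obtain ⟨V, hV, hVne, hVs⟩ := hasInt_iff.1 hI
      exact ⟨V, hV, hVne, fun y hy => hδU (hVs hy).2, Or.inl ⟨r, s, hs, fun y hy => (hVs hy).1⟩⟩
    push Not at hI
    obtain ⟨V1, hV1, hV1ne, hV1s, hcase⟩ := nd hA'.tf (isOpen_cube (c ∘ Fin.castSucc) δ)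
      ⟨_, self_mem_cube _ hδ⟩
    rcases hcase with ⟨r, s, hs, hsub⟩ | hdis
    · exact (hI r s hs (hA'.hasInt_of_tf hs (hasInt_iff.2 ⟨V1, hV1, hV1ne, hsub⟩))).elim
    have hloc : ∀ x ∈ V1, LocFin1 (fiber1 (Un A') x) := fun x hx =>
      hA'.locFin1_fiber (Set.disjoint_left.1 hdis hx)
    obtain ⟨p, hp⟩ := hV1ne
    have hdv := hA'.dv
    obtain ⟨N, ε, hε, hN⟩ := lemmaFin L (Un A') (c (Fin.last n)) p
    obtain ⟨ε2, hε2, hε2'⟩ := exists_between (lt_min hδ hε)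
    have hεδ := hε2'.trans_le (min_le_left _ _)
    have hεε := hε2'.trans_le (min_le_right _ _)
    let P : ℕ → Prop := fun k => ∃ V : Set (Fin n → R), IsOpen V ∧ V.Nonempty ∧ V ⊆ V1 ∩ cube p ε ∧
      ∃ r s, 0 < s ∧ ∀ x ∈ V, ∃ z : Fin k → R, Function.Injective z ∧
        ∀ l, (Fin.snoc x (z l) : Fin (n + 1) → R) ∈ A' r s ∧ |z l - c (Fin.last n)| < ε2
    have hP0 : P 0 := ⟨V1 ∩ cube p ε, hV1.inter (isOpen_cube _ _), ⟨p, hp, self_mem_cube p hε⟩, le_rfl,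
      0, δ, hδ, fun x _ => ⟨Fin.elim0, fun i => i.elim0, fun i => i.elim0⟩⟩
    have hPN : ∀ k, P k → k ≤ N := by
      rintro k ⟨V, hV, ⟨x, hx⟩, hVs, r, s, hs, hz⟩
      obtain ⟨z, hzi, hz⟩ := hz x hx
      by_contra hkN
      have := (cardLE_iff _ _).1 (hN x (hVs hx).2 (hloc x (hVs hx).1))
        (fun l => z (Fin.castLE (by omega) l)) (fun l => ⟨⟨r, s, hs, (hz _).1⟩, ?_⟩)
      · exact this (hzi.comp (Fin.castLE_injective _))
      · have := abs_lt.1 ((hz (Fin.castLE (by omega) l)).2.trans hεε)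
        constructor
        · rw [sub_le_iff_le_add']; exact (neg_lt_sub_iff_lt_add.1 this.1).le
        · exact (sub_lt_iff_lt_add'.1 this.2).le
    obtain ⟨k, ⟨V, hV, ⟨q, hq⟩, hVs, r, s, hs, hz⟩, hk⟩ := exists_max_nat hP0 hPN
    let W : Set (Fin (n + 1) → R) := {w | w ∘ Fin.castSucc ∈ V ∧ |w (Fin.last n) - c (Fin.last n)| < ε2}
    have hWo : IsOpen W := by
      refine (hV.preimage (continuous_comp Fin.castSucc)).inter ?_
      exact isOpen_lt (((continuous_apply _).sub continuous_const).abs) continuous_const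
    have hWne : W.Nonempty := ⟨Fin.snoc q (c (Fin.last n)), by
      refine ⟨?_, ?_⟩
      · rwa [snoc_comp']
      · rw [snoc_last']; simpa using hε2⟩
    have hWcc : W ⊆ ccube c δ := by
      rintro w ⟨h1, h2⟩ i
      induction i using Fin.lastCases with
      | last => exact (h2.trans hεδ).le
      | cast i => exact (hV1s (hVs h1).1 i).le
    have hnW : ¬ W ⊆ A' r s := fun hsub => hI r s hs (hasInt_iff.2 ⟨W, hWo, hWne, hsub⟩)
    rw [Set.not_subset] at hnW
    obtain ⟨d, hdW, hdA⟩ := hnW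
    obtain ⟨τ, hτ, hτs⟩ := exists_cube (hWo.inter (hA'.cl r s hs).isOpen_compl) ⟨hdW, hdA⟩
    have hcc2 : DV L (ccube d τ) := ⟨inferInstance⟩
    have hB := (hA'.interC _ (isClosed_ccube d τ)).image Fin.castSucc
    obtain ⟨V2, hV2, ⟨q2, hq2⟩, hV2s, hcase⟩ := nd hB (isOpen_cube (d ∘ Fin.castSucc) τ)
      ⟨_, self_mem_cube _ hτ⟩
    rcases hcase with ⟨r1, s1, hs1, hsub⟩ | hdis2
    · refine (hk ⟨V2, hV2, ⟨q2, hq2⟩, ?_, max r r1, min s s1, lt_min hs hs1, ?_⟩).elim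
      · intro x hx
        obtain ⟨w, ⟨_, hw⟩, rfl⟩ := hsub hx
        exact hVs (hτs hw).1.1
      · intro x hx
        obtain ⟨w, ⟨hwA, hw⟩, rfl⟩ := hsub hx
        obtain ⟨z, hzi, hz⟩ := hz _ (hτs hw).1.1
        refine ⟨Fin.snoc z (w (Fin.last n)), ?_, ?_⟩
        · rw [Fin.snoc_injective_iff]
          refine ⟨hzi, ?_⟩
          rintro ⟨l, hl⟩
          have := (hz l).1
          rw [hl, snoc_comp] at this
          exact (hτs hw).2 this
        · intro l
          induction l using Fin.lastCases with
          | last =>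
            simp only [Fin.snoc_last]
            rw [snoc_comp]
            exact ⟨hA'.max_mem' r hs1 hs hwA, (hτs hw).1.2⟩
          | cast l =>
            simp only [Fin.snoc_castSucc]
            exact ⟨hA'.max_mem r1 hs hs1 (hz l).1, (hz l).2⟩
    · have hsub : {w : Fin (n + 1) → R | w ∘ Fin.castSucc ∈ V2 ∧ |w (Fin.last n) - d (Fin.last n)| < τ} ⊆
          ccube d τ := by
        rintro w ⟨h1, h2⟩ i
        induction i using Fin.lastCases with
        | last => exact h2.le
        | cast i => exact (hV2s h1 i).le
      refine ⟨{w | w ∘ Fin.castSucc ∈ V2 ∧ |w (Fin.last n) - d (Fin.last n)| < τ}, ?_,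
        ⟨Fin.snoc q2 (d (Fin.last n)), ?_, ?_⟩, ?_, Or.inr ?_⟩
      · refine (hV2.preimage (continuous_comp Fin.castSucc)).inter ?_
        exact isOpen_lt (((continuous_apply _).sub continuous_const).abs) continuous_const
      · rwa [snoc_comp']
      · rw [snoc_last']; simpa using hτ
      · exact fun w hw => hδU (hWcc (hτs (hsub hw)).1)
      · rw [Set.disjoint_left]
        intro w hw hwA
        have : w ∈ Un A' := by rw [hUA']; exact ⟨hwA, hWcc (hτs (hsub hw)).1⟩
        obtain ⟨r', s', hs', hw'⟩ := this
        exact Set.disjoint_left.1 hdis2 hw.1 ⟨r', s', hs', w, ⟨hw', hsub hw⟩, rfl⟩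

end TStep
end OC

namespace OC

set_option linter.unusedSectionVars false
set_option linter.unusedVariables false

section Main
variable {R : Type*} [LinearOrder R] [AddCommGroup R] [IsOrderedAddMonoid R]
  [DenselyOrdered R] [Nontrivial R] [TopologicalSpace R] [OrderTopology R]
variable {L : FirstOrder.Language} [L.Structure R] [DL R L]

theorem shrink {X : Type*} [TopologicalSpace X] {n : ℕ} {Q : Fin n → Set X → Prop}
    (her : ∀ j V V', V' ⊆ V → Q j V → Q j V')
    (dense : ∀ j U, IsOpen U → U.Nonempty → ∃ V, IsOpen V ∧ V.Nonempty ∧ V ⊆ U ∧ Q j V)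
    {U : Set X} (hU : IsOpen U) (hne : U.Nonempty) :
    ∃ V, IsOpen V ∧ V.Nonempty ∧ V ⊆ U ∧ ∀ j, Q j V := by
  have : ∀ k, k ≤ n → ∃ V, IsOpen V ∧ V.Nonempty ∧ V ⊆ U ∧ ∀ j : Fin n, j.val < k → Q j V := by
    intro k
    induction k with
    | zero => exact fun _ => ⟨U, hU, hne, le_rfl, fun j hj => by omega⟩
    | succ k ih =>
      intro hk
      obtain ⟨V, hV, hVne, hVU, hQ⟩ := ih (by omega)
      obtain ⟨V', hV', hVne', hVV', hQ'⟩ := dense ⟨k, hk⟩ V hV hVne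
      refine ⟨V', hV', hVne', hVV'.trans hVU, fun j hj => ?_⟩
      rcases Nat.lt_succ_iff_lt_or_eq.1 hj with h | h
      · exact her j _ _ hVV' (hQ j h)
      · have : j = ⟨k, hk⟩ := Fin.ext h
        rw [this]; exact hQ'
  obtain ⟨V, h1, h2, h3, h4⟩ := this n le_rfl
  exact ⟨V, h1, h2, h3, fun j => h4 j j.2⟩

variable (L) in
theorem dv_closure {n : ℕ} (S : Set (Fin n → R)) [DV L S] : DV L (closure S) := by
  have : closure S = {x | ∀ ε, 0 < ε → ∃ y : Fin n → R, y ∈ S ∧ y ∈ cube x ε} := by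
    ext x; exact mem_closure_iff_cube
  rw [this]
  exact ⟨inferInstance⟩

/-- the bad set -/
def Kset {n : ℕ} (S : Set (Fin n → R)) : Set (Fin n → R) := closure (closure S \ S)

theorem dv_kset {n : ℕ} (S : Set (Fin n → R)) [DV L S] : DV L (Kset S) := by
  have := dv_closure L S
  have h2 : DV L (closure S \ S) := by
    have : DV L (closure S ∩ Sᶜ) := ⟨inferInstance⟩
    rwa [Set.diff_eq]
  exact dv_closure L _

theorem main_lemma {n d : ℕ} {A : R → R → Set (Fin n → R)} (hA : DSig L A)
    (hdim : ∀ f : Fin (d + 1) → Fin n, ¬ HasInt ((fun y => y ∘ f) '' Un A)) (f : Fin d → Fin n) :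
    ¬ HasInt ((fun y => y ∘ f) '' (Un A ∩ Kset (Un A))) := by
  intro hI
  have hdA := hA.d
  have hdv := hA.dv
  have hdK : DV L (Kset (Un A)) := dv_kset _
  have hKcl : IsClosed (Kset (Un A)) := isClosed_closure
  rw [← un_interC, ← un_image] at hI
  obtain ⟨r0, s0, hs0, hI0⟩ := baire ((hA.interC _ hKcl).image f) hI
  obtain ⟨U0, hU0, hU0ne, hU0s⟩ := hasInt_iff.1 hI0
  -- step 1: local finiteness of the coordinates of the fibres
  let g : Fin n → Fin (d + 1) → Fin n := fun j => (Fin.snoc f j : Fin (d + 1) → Fin n)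
  let B : Fin n → R → R → Set (Fin (d + 1) → R) := fun j r s => (fun y => y ∘ g j) '' A r s
  have hB : ∀ j, DSig L (B j) := fun j => hA.image (g j)
  have hBI : ∀ j r s, 0 < s → ¬ HasInt (B j r s) := fun j r s hs h =>
    hdim (g j) (h.mono (image_mono fun y hy => ⟨r, s, hs, hy⟩))
  obtain ⟨V, hV, ⟨c0, hc0⟩, hVU, hVQ⟩ := shrink (X := Fin d → R)
    (Q := fun j V => ∀ u ∈ V, LocFin1 (fiber1 (Un (B j)) u))
    (fun j V V' h hQ u hu => hQ u (h hu))
    (fun j U hU hne => by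
      obtain ⟨V, hV, hVne, hVU, hc⟩ := nd (hB j).tf hU hne
      refine ⟨V, hV, hVne, hVU, fun u hu => ?_⟩
      rcases hc with ⟨r, s, hs, hsub⟩ | hdis
      · exact (hBI j r s hs ((hB j).hasInt_of_tf hs (hasInt_iff.2 ⟨V, hV, hVne, hsub⟩))).elim
      · exact (hB j).locFin1_fiber (Set.disjoint_left.1 hdis hu)) hU0 hU0ne
  have hfib : ∀ j y, y ∈ Un A → y j ∈ fiber1 (Un (B j)) (y ∘ f) := by
    rintro j y ⟨r, s, hs, hy⟩
    refine ⟨r, s, hs, y, hy, ?_⟩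
    funext i
    induction i using Fin.lastCases with
    | last => simp [g]
    | cast i => simp [g]
  -- step 2: a cluster point
  obtain ⟨δ, hδ, hδV⟩ := exists_cube hV hc0
  let C : Set (Fin n → R) := A r0 s0 ∩ Kset (Un A) ∩ {y | y ∘ f ∈ ccube c0 δ}
  have hCd : D1V L (fun _ : R => C) := ⟨inferInstance⟩
  obtain ⟨M, hM⟩ := hA.bd r0 s0 hs0
  obtain ⟨x0, hx0, hx0I⟩ := cluster (large_hasInt (L := L) f) (fun _ => C)
    (fun _ _ => ((hA.cl r0 s0 hs0).inter hKcl).inter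
      ((isClosed_ccube c0 δ).preimage (continuous_comp f))) M (fun _ _ y hy => hM y hy.1.1)
    (fun _ _ _ _ => le_rfl) (fun _ _ => by
      refine ⟨c0, δ, hδ, fun u hu => ?_⟩
      have hu' := cube_sub_ccube _ _ hu
      obtain ⟨y, hy, rfl⟩ := hU0s (hVU (hδV hu'))
      exact ⟨y, ⟨hy, hu'⟩, rfl⟩)
  have hx0V : x0 ∘ f ∈ V := hδV (hx0 δ hδ).2
  -- step 3: uniform bounds
  have hfin : ∀ j, ∃ N : ℕ, ∃ ε, 0 < ε ∧ ∀ u ∈ cube (x0 ∘ f) ε, LocFin1 (fiber1 (Un (B j)) u) →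
      CardLE (fiber1 (Un (B j)) u ∩ Icc (x0 j - ε) (x0 j + ε)) N := fun j => by
    have := (hB j).dv
    exact lemmaFin L (Un (B j)) (x0 j) (x0 ∘ f)
  choose N e he hN using hfin
  obtain ⟨e1, he1, he1'⟩ := exists_lt_all he
  obtain ⟨e2, he2, he2V⟩ := exists_cube hV hx0V
  obtain ⟨ε, hε, hε'⟩ := exists_between (lt_min he1 he2)
  have hεe : ∀ j, ε < e j := fun j => (hε'.trans_le (min_le_left _ _)).trans (he1' j)
  have hεV : cube (x0 ∘ f) ε ⊆ V := fun u hu =>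
    he2V (cube_sub_ccube _ _ (cube_mono _ (hε'.trans_le (min_le_right _ _)).le hu))
  have hcount : ∀ u ∈ cube (x0 ∘ f) ε, ∀ (k : ℕ) (z : Fin k → Fin n → R), Function.Injective z →
      (∀ l, z l ∈ Un A ∧ z l ∈ cube x0 ε ∧ z l ∘ f = u) → k ≤ ∏ j, N j := by
    intro u hu k z hzi hz
    have hcard : ∀ j, CardLE (fiber1 (Un (B j)) u ∩ Icc (x0 j - e j) (x0 j + e j)) (N j) := fun j =>
      hN j u (cube_mono _ (hεe j).le hu) (hVQ j u (hεV hu))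
    classical
    let T : Finset (Fin n → R) := Fintype.piFinset fun j => (hcard j).1.toFinset
    have hT : T.card ≤ ∏ j, N j := by
      rw [Fintype.card_piFinset]
      refine Finset.prod_le_prod' fun j _ => ?_
      rw [← Set.ncard_eq_toFinset_card _ (hcard j).1]
      exact (hcard j).2
    refine le_trans ?_ hT
    have : (Finset.univ.map ⟨z, hzi⟩).card ≤ T.card := by
      refine Finset.card_le_card fun y hy => ?_
      simp only [Finset.mem_map, Finset.mem_univ, true_and, Function.Embedding.coeFn_mk] at hy
      obtain ⟨l, rfl⟩ := hy
      rw [Fintype.mem_piFinset]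
      intro j
      rw [Set.Finite.mem_toFinset]
      obtain ⟨h1, h2, h3⟩ := hz l
      refine ⟨h3 ▸ hfib j _ h1, ?_⟩
      have := abs_lt.1 ((h2 j).trans (hεe j))
      constructor
      · rw [sub_le_iff_le_add']; exact (neg_lt_sub_iff_lt_add.1 this.1).le
      · exact (sub_lt_iff_lt_add'.1 this.2).le
    simpa using this
  -- step 4: maximal number of points
  obtain ⟨ε4, hε4, hε4'⟩ := exists_between hε
  obtain ⟨V4, hV4, hV4ne, hV4s⟩ := hasInt_iff.1 (hx0I ε4 hε4)
  have hV4c : V4 ⊆ cube (x0 ∘ f) ε := by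
    intro u hu
    obtain ⟨y, ⟨_, hy⟩, rfl⟩ := hV4s hu
    exact cube_comp f (ccube_sub_cube _ hε4' hy)
  let P : ℕ → Prop := fun k => ∃ V' : Set (Fin d → R), IsOpen V' ∧ V'.Nonempty ∧ V' ⊆ V4 ∧
    ∃ r s, 0 < s ∧ ∀ u ∈ V', ∃ z : Fin k → Fin n → R, Function.Injective z ∧
      ∀ l, z l ∈ A r s ∧ z l ∈ cube x0 ε ∧ z l ∘ f = u
  have hP0 : P 0 := ⟨V4, hV4, hV4ne, le_rfl, r0, s0, hs0, fun u _ =>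
    ⟨Fin.elim0, fun i => i.elim0, fun i => i.elim0⟩⟩
  have hPN : ∀ k, P k → k ≤ ∏ j, N j := by
    rintro k ⟨V', hV', ⟨u, hu⟩, hVs, r, s, hs, hz⟩
    obtain ⟨z, hzi, hz⟩ := hz u hu
    exact hcount u (hV4c (hVs hu)) k z hzi (fun l => ⟨⟨r, s, hs, (hz l).1⟩, (hz l).2⟩)
  obtain ⟨k, ⟨V', hV', hV'ne, hV's, r, s, hs, hz⟩, hk⟩ := exists_max_nat hP0 hPN
  -- step 5
  have hOo : IsOpen (cube x0 ε ∩ (A r s)ᶜ) := (isOpen_cube _ _).inter (hA.cl r s hs).isOpen_compl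
  have hOd : DV L (cube x0 ε ∩ (A r s)ᶜ) := ⟨inferInstance⟩
  obtain ⟨O, hO, hOU⟩ := isDS_open L _ hOo
  obtain ⟨V2, hV2, ⟨u, hu⟩, hV2s, hcase⟩ := nd ((hA.inter hO).image f) hV' hV'ne
  rcases hcase with ⟨r1, s1, hs1, hsub⟩ | hdis
  · refine hk ⟨V2, hV2, ⟨u, hu⟩, hV2s.trans hV's, max r r1, min s s1, lt_min hs hs1, ?_⟩
    intro u hu
    obtain ⟨z, hzi, hz⟩ := hz u (hV2s hu)
    obtain ⟨y, ⟨hyA, hyO⟩, hyu⟩ := hsub hu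
    have hy' : y ∈ cube x0 ε ∩ (A r s)ᶜ := by rw [hOU]; exact ⟨r1, s1, hs1, hyO⟩
    refine ⟨Fin.snoc z y, ?_, ?_⟩
    · rw [Fin.snoc_injective_iff]
      refine ⟨hzi, ?_⟩
      rintro ⟨l, hl⟩
      exact hy'.2 (hl ▸ (hz l).1)
    · intro l
      induction l using Fin.lastCases with
      | last =>
        simp only [Fin.snoc_last]
        exact ⟨hA.max_mem' r hs1 hs hyA, hy'.1, hyu⟩
      | cast l =>
        simp only [Fin.snoc_castSucc]
        exact ⟨hA.max_mem r1 hs hs1 (hz l).1, (hz l).2⟩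
  · obtain ⟨y, ⟨hyC, hyc⟩, rfl⟩ := hV4s (hV's (hV2s hu))
    have hyK : y ∈ Kset (Un A) := hyC.1.2
    have hO' : IsOpen (cube x0 ε ∩ {y | y ∘ f ∈ V2}) :=
      (isOpen_cube _ _).inter (hV2.preimage (continuous_comp f))
    obtain ⟨y', hy'O, hy'1, hy'2⟩ := mem_closure_iff.1 hyK _ hO' ⟨ccube_sub_cube _ hε4' hyc, hu⟩
    apply hy'2
    refine ⟨r, s, hs, ?_⟩
    have hsub : Un A ∩ (cube x0 ε ∩ {y | y ∘ f ∈ V2}) ⊆ A r s := by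
      rintro w ⟨hw, hw1, hw2⟩
      by_contra hwn
      refine Set.disjoint_left.1 hdis hw2 ?_
      rw [un_image, hA.un_inter hO, ← hOU]
      exact ⟨w, ⟨hw, hw1, hwn⟩, rfl⟩
    rw [← (hA.cl r s hs).closure_eq]
    refine closure_mono hsub ?_
    rw [mem_closure_iff]
    intro Z hZ hyZ
    obtain ⟨w, ⟨hwZ, hwO⟩, hwA⟩ := mem_closure_iff.1 hy'1 _ (hZ.inter hO') ⟨hyZ, hy'O⟩
    exact ⟨w, hwZ, hwA, hwO⟩

theorem compl_aux : ∀ (d : ℕ) {n : ℕ} {A : R → R → Set (Fin n → R)}, DSig L A →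
    (∀ f : Fin d → Fin n, ¬ HasInt ((fun y => y ∘ f) '' Un A)) → IsDS L (Un A)ᶜ
  | 0, n, A, hA, hdim => by
    have : Un A = ∅ := by
      rw [Set.eq_empty_iff_forall_notMem]
      intro y hy
      obtain ⟨u, hu⟩ := exists_zero_lt (α := R)
      exact hdim Fin.elim0 ⟨fun i => i.elim0, u, hu, fun x _ => ⟨y, hy, Subsingleton.elim _ _⟩⟩
    rw [this, compl_empty]
    have : DV L (univ : Set (Fin n → R)) := DV.of_isDef Set.definable_univ
    exact isDS_open L _ isOpen_univ
  | d + 1, n, A, hA, hdim => by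
    have hdv := hA.dv
    have hdK : DV L (Kset (Un A)) := dv_kset _
    have hdC : DV L (closure (Un A)) := dv_closure L _
    have hdC' : DV L (closure (Un A))ᶜ := ⟨inferInstance⟩
    have hKcl : IsClosed (Kset (Un A)) := isClosed_closure
    have hA1 := hA.interC _ hKcl
    have ih := compl_aux d hA1 (fun f => by rw [un_interC]; exact main_lemma hA hdim f)
    rw [un_interC] at ih
    have := ((isDS_open L _ (isClosed_closure (s := Un A)).isOpen_compl).union
      (isDS_closed L _ hKcl)).inter ih
    convert this using 1
    ext y
    constructor
    · intro hy
      refine ⟨?_, fun h => hy h.1⟩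
      by_cases hc : y ∈ closure (Un A)
      · exact Or.inr (subset_closure ⟨hc, hy⟩)
      · exact Or.inl hc
    · rintro ⟨h1 | h1, h2⟩ hy
      · exact h1 (subset_closure hy)
      · exact h2 ⟨hy, h1⟩

theorem IsDS.compl {n : ℕ} {X : Set (Fin n → R)} (h : IsDS L X) : IsDS L Xᶜ := by
  obtain ⟨A, hA, rfl⟩ := h
  refine compl_aux (n + 1) hA ?_
  rintro f ⟨c, ε, h0, hc⟩
  obtain ⟨i, j, hfij, hij⟩ : ∃ i j, f i = f j ∧ i ≠ j := by
    by_contra! h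
    have := Fintype.card_le_of_injective f (fun i j => h i j)
    simp at this
  obtain ⟨t, ht0, ht⟩ := exists_between h0
  have e1 : c i = c j := by
    obtain ⟨y, _, rfl⟩ := hc (self_mem_cube c h0)
    simp [hfij]
  obtain ⟨y, _, hy⟩ := hc (show Function.update c i (c i + t) ∈ cube c ε from fun l => by
    by_cases hl : l = i
    · subst hl; simpa [abs_of_pos ht0] using ht
    · simpa [Function.update_of_ne hl] using h0)
  have h1 := congrFun hy i
  have h2 := congrFun hy j
  simp only [Function.comp, Function.update_self, Function.update_of_ne hij.symm] at h1 h2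
  rw [hfij, h2, ← e1] at h1
  exact ht0.ne' (by simpa using h1)

end Main
end OC

namespace OC

set_option linter.unusedSectionVars false
set_option linter.unusedVariables false

section Fin
variable {R : Type*} [LinearOrder R] [AddCommGroup R] [IsOrderedAddMonoid R]
  [DenselyOrdered R] [Nontrivial R] [TopologicalSpace R] [OrderTopology R]
variable {L : FirstOrder.Language} [L.Structure R] [DL R L]

theorem term_cases {m k : ℕ} (t : ((openCoreLang L R)[[(univ : Set R)]]).Term (Fin m ⊕ Fin k)) :
    letI := openCoreStructure L R
    (∃ i : Fin (m + k), ∀ v : Fin (m + k) → R,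
      t.realize (Sum.elim (v ∘ Fin.castAdd k) (v ∘ Fin.natAdd m)) = v i) ∨
    ∃ c : R, ∀ v : Fin (m + k) → R,
      t.realize (Sum.elim (v ∘ Fin.castAdd k) (v ∘ Fin.natAdd m)) = c := by
  let _ := openCoreStructure L R
  cases t with
  | var i =>
    left
    rcases i with i | i
    · exact ⟨Fin.castAdd k i, fun v => rfl⟩
    · exact ⟨Fin.natAdd m i, fun v => rfl⟩
  | @func l f ts =>
    right
    rcases f with f | f
    · exact Empty.elim f
    · cases l with
      | zero =>
        refine ⟨Language.Structure.funMap (L := (openCoreLang L R)[[(univ : Set R)]]) (Sum.inr f)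
          Fin.elim0, fun v => ?_⟩
        simp only [Language.Term.realize]
        congr 1
        exact Subsingleton.elim _ _
      | succ l => exact PEmpty.elim f

theorem term_tm {m k : ℕ} (t : ((openCoreLang L R)[[(univ : Set R)]]).Term (Fin m ⊕ Fin k)) :
    letI := openCoreStructure L R
    Tm L (fun v : Fin (m + k) → R => t.realize (Sum.elim (v ∘ Fin.castAdd k) (v ∘ Fin.natAdd m))) ∧
    Continuous (fun v : Fin (m + k) → R =>
      t.realize (Sum.elim (v ∘ Fin.castAdd k) (v ∘ Fin.natAdd m))) := by
  let _ := openCoreStructure L R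
  rcases term_cases t with ⟨i, hi⟩ | ⟨c, hc⟩
  · simp only [hi]
    exact ⟨inferInstance, continuous_apply i⟩
  · simp only [hc]
    exact ⟨inferInstance, continuous_const⟩

theorem DV.of_df {n : ℕ} {P : (Fin n → R) → Prop} (h : Df L P) : DV L {v | P v} :=
  DV.of_isDef h.out

theorem formula_isDS {m k : ℕ} (φ : ((openCoreLang L R)[[(univ : Set R)]]).BoundedFormula (Fin m) k) :
    letI := openCoreStructure L R
    IsDS L {v : Fin (m + k) → R | φ.Realize (v ∘ Fin.castAdd k) (v ∘ Fin.natAdd m)} := by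
  let _ := openCoreStructure L R
  induction φ with
  | @falsum k =>
    have : DV L (∅ : Set (Fin (m + k) → R)) := DV.of_isDef Set.definable_empty
    exact isDS_closed L ∅ isClosed_empty
  | equal t₁ t₂ =>
    obtain ⟨h1, c1⟩ := term_tm t₁
    obtain ⟨h2, c2⟩ := term_tm t₂
    have := DV.of_df (L := L) (Df.eq (hs := h1) (ht := h2))
    exact @isDS_closed _ _ _ _ _ _ _ _ L _ _ _ _ this (isClosed_eq c1 c2)
  | rel S ts =>
    rcases S with S | S
    · obtain ⟨S, hS, hSo⟩ := S
      have hd : DV L {v : Fin (m + _) → R | (fun i => (ts i).realize (Sum.elim (v ∘ Fin.castAdd _) (v ∘ Fin.natAdd m))) ∈ S} :=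
        DV.of_df (Df.substV (P := fun w => w ∈ S) ⟨hS⟩ ⟨fun i => (term_tm (ts i)).1.out⟩)
      exact @isDS_open _ _ _ _ _ _ _ _ L _ _ _ _ hd (hSo.preimage (continuous_pi fun i => (term_tm (ts i)).2))
    · exact isEmptyElim (α := (Language.constantsOn (univ : Set R)).Relations _) S
  | imp f₁ f₂ h₁ h₂ =>
    convert h₁.compl.union h₂ using 1
    ext v
    simp only [Language.BoundedFormula.realize_imp, mem_ofPred_eq, mem_union, mem_compl_iff]
    tauto
  | @all k f h =>
    convert (h.compl.image (Fin.castSucc : Fin (m + k) → Fin (m + k + 1))).compl using 1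
    ext v
    simp only [Language.BoundedFormula.realize_all, mem_ofPred_eq, mem_compl_iff, mem_image,
      not_exists, not_and]
    have key : ∀ w : Fin (m + k + 1) → R,
        (w ∘ Fin.castSucc) ∘ Fin.castAdd k = w ∘ Fin.castAdd (k + 1) ∧
        w ∘ Fin.natAdd m = (Fin.snoc ((w ∘ Fin.castSucc) ∘ Fin.natAdd m) (w (Fin.last _)) : Fin (k + 1) → R) := by
      intro w
      refine ⟨rfl, ?_⟩
      funext i
      induction i using Fin.lastCases with
      | last => simp only [Fin.snoc_last]; rfl
      | cast i => simp only [Fin.snoc_castSucc]; rfl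
    constructor
    · rintro h w hw rfl
      apply hw
      have h1 := h (w (Fin.last _))
      rw [(key w).1, ← (key w).2] at h1
      exact h1
    · intro h x
      by_contra hc
      refine h (Fin.snoc v x) ?_ (by funext i; simp)
      intro h'
      apply hc
      change f.Realize ((Fin.snoc v x : Fin (m + k + 1) → R) ∘ Fin.castAdd (k + 1))
        ((Fin.snoc v x : Fin (m + k + 1) → R) ∘ Fin.natAdd m) at h'
      have k0 : (Fin.snoc v x : Fin (m + k + 1) → R) ∘ Fin.castSucc = v := by funext i; simp
      have k1 := (key (Fin.snoc v x)).1
      have k2 := (key (Fin.snoc v x)).2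
      rw [k0] at k1 k2
      rw [Fin.snoc_last] at k2
      rw [k2, ← k1] at h'
      exact h'

theorem isDS_of_openCore {n : ℕ} {X : Set (Fin n → R)} (h : DefinableInOpenCore L R X) :
    IsDS L X := by
  let _ := openCoreStructure L R
  obtain ⟨φ, rfl⟩ := h
  have h1 := formula_isDS φ
  have h2 : (Set.ofPred φ.Realize : Set (Fin n → R)) = {v : Fin (n + 0) → R |
      Language.BoundedFormula.Realize φ (v ∘ Fin.castAdd 0) (v ∘ Fin.natAdd n)} := by
    ext v
    have h3 : (default : Fin 0 → R) = v ∘ Fin.natAdd n := Subsingleton.elim _ _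
    change Language.BoundedFormula.Realize φ v default ↔
      Language.BoundedFormula.Realize φ v (v ∘ Fin.natAdd n)
    rw [h3]
  rw [h2]
  exact h1

theorem mem_closure_Ioo {S : Set R} {y : R} :
    y ∈ closure S ↔ ∀ ε, 0 < ε → ∃ z, z ∈ S ∧ z ∈ Ioo (y - ε) (y + ε) := by
  rw [mem_closure_iff_nhds_basis (nhds_basis_Ioo_pos y)]

theorem mem_frontier_Ioo {S : Set R} {y : R} :
    y ∈ frontier S ↔ ∀ ε, 0 < ε → (∃ z, z ∈ S ∧ z ∈ Ioo (y - ε) (y + ε)) ∧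
      ∃ z, z ∉ S ∧ z ∈ Ioo (y - ε) (y + ε) := by
  rw [frontier_eq_closure_inter_closure, mem_inter_iff, mem_closure_Ioo, mem_closure_Ioo]
  constructor
  · exact fun h ε h0 => ⟨h.1 ε h0, h.2 ε h0⟩
  · exact fun h => ⟨fun ε h0 => (h ε h0).1, fun ε h0 => (h ε h0).2⟩

theorem not_open_sub_frontier {S O : Set R} (hO : IsOpen O) (hne : O.Nonempty)
    (h : O ⊆ frontier S) (h' : O ⊆ S) : False := by
  obtain ⟨y, hy⟩ := hne
  exact (h hy).2 (mem_interior.2 ⟨O, h', hO, hy⟩)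

theorem frontier_locFin {m : ℕ} {A B : R → R → Set (Fin (m + 1) → R)} (hA : DSig L A)
    (hB : DSig L B) (hAB : (Un A)ᶜ = Un B) (x : Fin m → R) :
    LocFin1 (frontier (fiber1 (Un A) x)) := by
  have := hA.d
  have := hB.d
  have hd : D1 L (frontier (fiber1 (Un A) x)) := by
    have : D1 L {y | ∀ ε, 0 < ε → (∃ z, z ∈ fiber1 (Un A) x ∧ z ∈ Ioo (y - ε) (y + ε)) ∧
      ∃ z, ¬ z ∈ fiber1 (Un A) x ∧ z ∈ Ioo (y - ε) (y + ε)} := ⟨inferInstance⟩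
    convert this using 1
    ext y; exact mem_frontier_Ioo
  refine lemmaC L _ isClosed_frontier ?_
  intro u v huv
  by_contra! hcon
  obtain ⟨u', hu, huv'⟩ := exists_between huv
  obtain ⟨v', huv'', hv⟩ := exists_between huv'
  have hsub : Icc u' v' ⊆ frontier (fiber1 (Un A) x) := fun y hy =>
    hcon y (hu.trans_le hy.1) (hy.2.trans_lt hv)
  have hE : D21 L (fun r s => (fiber1 (A r s) x ∪ fiber1 (B r s) x) ∩ Icc u' v') :=
    ⟨inferInstance⟩
  have hclA : ∀ r s, 0 < s → IsClosed (fiber1 (A r s) x) := fun r s hs =>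
    (hA.cl r s hs).preimage (continuous_snoc x)
  have hlf := dich1 L (fun r s => (fiber1 (A r s) x ∪ fiber1 (B r s) x) ∩ Icc u' v')
    (fun r s hs => ((hclA r s hs).union ((hB.cl r s hs).preimage (continuous_snoc x))).inter
      isClosed_Icc)
    (fun r r' s s' h1 h2 h3 z hz => ⟨hz.1.imp (fun h => hA.mono r r' s s' h1 h2 h3 h)
      (fun h => hB.mono r r' s s' h1 h2 h3 h), hz.2⟩) ?_
  · obtain ⟨y, hy1, hy2, hy⟩ := hlf.noInt1 u' v' huv''
    apply hy
    by_cases h : Fin.snoc x y ∈ Un A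
    · obtain ⟨r, s, hs, h⟩ := h
      exact ⟨r, s, hs, Or.inl h, hy1.le, hy2.le⟩
    · have h' : Fin.snoc x y ∈ Un B := hAB ▸ h
      obtain ⟨r, s, hs, h⟩ := h'
      exact ⟨r, s, hs, Or.inr h, hy1.le, hy2.le⟩
  · intro r s hs p q hpq
    by_contra! hc
    by_cases hIA : Ioo p q ⊆ fiber1 (A r s) x
    · exact not_open_sub_frontier isOpen_Ioo (nonempty_Ioo.2 hpq)
        (fun y hy => hsub (hc y hy.1 hy.2).2) (fun y hy => ⟨r, s, hs, hIA hy⟩)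
    · rw [Set.not_subset] at hIA
      obtain ⟨z, hz, hzA⟩ := hIA
      refine not_open_sub_frontier (S := (fiber1 (Un A) x)ᶜ)
        (isOpen_Ioo.inter (hclA r s hs).isOpen_compl) ⟨z, hz, hzA⟩
        (fun y hy => ?_) (fun y hy => ?_)
      · rw [frontier_compl]; exact hsub (hc y hy.1.1 hy.1.2).2
      · have h1 : Fin.snoc x y ∈ Un B := ⟨r, s, hs, (hc y hy.1.1 hy.1.2).1.resolve_left hy.2⟩
        rw [← hAB] at h1
        exact h1

variable (L) in
theorem exists_frontier (S : Set R) [D1 L S] {z w : R} (hz : z ∈ S) (hw : w ∉ S) (hzw : z < w) :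
    ∃ e ∈ frontier S, z ≤ e ∧ e ≤ w := by
  have : D1 L {y | y ∈ S ∧ y ≤ w} := ⟨inferInstance⟩
  have hne : {y | y ∈ S ∧ y ≤ w}.Nonempty := ⟨z, hz, hzw.le⟩
  obtain ⟨e, he⟩ := exists_lub L {y | y ∈ S ∧ y ≤ w} hne ⟨w, fun y hy => hy.2⟩
  have hew : e ≤ w := he.2 fun y hy => hy.2
  refine ⟨e, ?_, he.1 ⟨hz, hzw.le⟩, hew⟩
  rw [frontier_eq_closure_inter_closure]
  refine ⟨closure_mono (fun y hy => hy.1) (he.mem_closure hne), ?_⟩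
  by_cases heS : e ∈ S
  · have hlt : e < w := lt_of_le_of_ne hew fun h => hw (h ▸ heS)
    have h1 : Ioo e w ⊆ Sᶜ := fun y hy hyS => (he.1 ⟨hyS, hy.2.le⟩).not_gt hy.1
    refine closure_mono h1 ?_
    rw [closure_Ioo hlt.ne]
    exact ⟨le_rfl, hlt.le⟩
  · exact subset_closure heS

variable (L) in
theorem exists_frontier' (S : Set R) [D1 L S] {z w : R} (hz : z ∈ S) (hw : w ∉ S) :
    ∃ e ∈ frontier S, min z w ≤ e ∧ e ≤ max z w := by
  have hne : z ≠ w := fun h => hw (h ▸ hz)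
  rcases lt_or_gt_of_ne hne with h | h
  · rw [min_eq_left h.le, max_eq_right h.le]
    exact exists_frontier L S hz hw h
  · rw [min_eq_right h.le, max_eq_left h.le]
    have : D1 L Sᶜ := ⟨inferInstance⟩
    rw [← frontier_compl]
    exact exists_frontier L Sᶜ hw (by simpa using hz) h

variable (L) in
theorem finUnion (S : Set R) [D1 L S] {c d : R} (hF : (frontier S ∩ Icc c d).Finite) :
    FinUnionPtsIntervals (S ∩ Ioo c d) := by
  classical
  let F : Finset R := insert c (insert d hF.toFinset)
  refine ⟨F.filter (fun y => y ∈ S ∩ Ioo c d),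
    (F ×ˢ F).filter (fun p => Ioo p.1 p.2 ⊆ S ∩ Ioo c d), ?_⟩
  ext x
  constructor
  · intro hx
    by_cases hxF : x ∈ F
    · left; simpa using ⟨hxF, hx⟩
    right
    have hc : c ∈ F.filter (· < x) := by simp [F, hx.2.1]
    have hd : d ∈ F.filter (x < ·) := by simp [F, hx.2.2]
    let p := (F.filter (· < x)).max' ⟨c, hc⟩
    let q := (F.filter (x < ·)).min' ⟨d, hd⟩
    have hp : p ∈ F ∧ p < x := by simpa using (F.filter (· < x)).max'_mem ⟨c, hc⟩
    have hq : q ∈ F ∧ x < q := by simpa using (F.filter (x < ·)).min'_mem ⟨d, hd⟩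
    have hcp : c ≤ p := Finset.le_max' _ _ hc
    have hqd : q ≤ d := Finset.min'_le _ _ hd
    have hno : ∀ e ∈ Ioo p q, e ∉ F := by
      intro e he heF
      rcases lt_trichotomy e x with h | h | h
      · exact (Finset.le_max' (F.filter (· < x)) e (by simp [heF, h])).not_gt he.1
      · exact hxF (h ▸ heF)
      · exact (Finset.min'_le (F.filter (x < ·)) e (by simp [heF, h])).not_gt he.2
    simp only [mem_iUnion, Finset.mem_filter, Finset.mem_product]
    refine ⟨(p, q), ⟨⟨hp.1, hq.1⟩, fun z hz => ⟨?_, hcp.trans_lt hz.1, hz.2.trans_le hqd⟩⟩, hp.2, hq.2⟩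
    by_contra hzS
    obtain ⟨e, he, he1, he2⟩ := exists_frontier' L S hx.1 hzS
    have h1 : p < e := (lt_min hp.2 hz.1).trans_le he1
    have h2 : e < q := he2.trans_lt (max_lt hq.2 hz.2)
    refine hno e ⟨h1, h2⟩ ?_
    simp only [F, Finset.mem_insert, Set.Finite.mem_toFinset]
    exact Or.inr (Or.inr ⟨he, (hcp.trans_lt h1).le, (h2.trans_le hqd).le⟩)
  · rintro (h | h)
    · simp only [Finset.coe_filter, mem_ofPred_eq] at h
      exact h.2
    · simp only [mem_iUnion, Finset.mem_filter] at h
      obtain ⟨p, hp, hx⟩ := h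
      exact hp.2 hx

theorem final {m : ℕ} {X : Set (Fin (m + 1) → R)} (hX : IsDS L X) (a : R) (b : Fin m → R) :
    ∃ c d : R, c < a ∧ a < d ∧ ∃ B : Set (Fin m → R), OpenBox B ∧ b ∈ B ∧
      ∀ x ∈ B, FinUnionPtsIntervals (fiber1 X x ∩ Set.Ioo c d) := by
  have hXc := hX.compl
  have hXd := hX.dv
  obtain ⟨A, hA, rfl⟩ := hX
  obtain ⟨B, hB, hAB⟩ := hXc
  let Y : Set (Fin (m + 1) → R) := {w | ∀ ε, 0 < ε →
    (∃ z, z ∈ fiber1 (Un A) (w ∘ Fin.castSucc) ∧ z ∈ Ioo (w (Fin.last m) - ε) (w (Fin.last m) + ε)) ∧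
    ∃ z, ¬ z ∈ fiber1 (Un A) (w ∘ Fin.castSucc) ∧
      z ∈ Ioo (w (Fin.last m) - ε) (w (Fin.last m) + ε)}
  have hY : DV L Y := ⟨inferInstance⟩
  have hfib : ∀ x, fiber1 Y x = frontier (fiber1 (Un A) x) := by
    intro x
    ext y
    rw [mem_frontier_Ioo]
    have e1 : (Fin.snoc x y : Fin (m + 1) → R) ∘ Fin.castSucc = x := by funext i; simp
    have e2 : (Fin.snoc x y : Fin (m + 1) → R) (Fin.last m) = y := by simp
    change (∀ ε, 0 < ε → _) ↔ _
    rw [e1, e2]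
  obtain ⟨N, ε, h0, hN⟩ := lemmaFin L Y a b
  refine ⟨a - ε, a + ε, sub_lt_self _ h0, lt_add_of_pos_right _ h0, cube b ε,
    ⟨fun i => b i - ε, fun i => b i + ε, ?_⟩, self_mem_cube b h0, fun x hx => ?_⟩
  · ext x
    refine forall_congr' fun i => ?_
    rw [abs_lt, neg_lt_sub_iff_lt_add, sub_lt_iff_lt_add', sub_lt_iff_lt_add']
  · have : D1 L (fiber1 (Un A) x) := ⟨inferInstance⟩
    have := (hN x hx (by rw [hfib]; exact frontier_locFin hA hB hAB x)).1
    rw [hfib] at this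
    exact finUnion L _ this

end Fin
end OC

/-- If `𝓡` is a definably complete expansion of a densely linearly
ordered abelian group satisfying `LUF₂`, then the open core of `𝓡` is a uniformly
locally o-minimal structure of the second kind: for every set `X ⊆ R^{m+1}` definable in
the open core, every `a ∈ R` and every `b ∈ R^m` there exist an open interval `I ∋ a`
and an open box `B ∋ b` such that `X_x ∩ I` is a finite union of points and open
intervals for every `x ∈ B`. -/
theorem openCore_uniformlyLocallyOMinimal_secondKind
    {R : Type*} (L : FirstOrder.Language) [L.Structure R]
    [LinearOrder R] [DenselyOrdered R] [AddCommGroup R]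
    [CovariantClass R R (· + ·) (· < ·)] [TopologicalSpace R] [OrderTopology R]
    (hlt : IsDefinable L {v : Fin 2 → R | v 0 < v 1})
    (hadd : IsDefinable L {v : Fin 3 → R | v 0 + v 1 = v 2})
    (hDC : DCProp L R) (hLUF2 : LUF2 L R) :
    ∀ (m : ℕ) (X : Set (Fin (m + 1) → R)), DefinableInOpenCore L R X →
      ∀ (a : R) (b : Fin m → R),
        ∃ c d : R, c < a ∧ a < d ∧
          ∃ B : Set (Fin m → R), OpenBox B ∧ b ∈ B ∧
            ∀ x ∈ B, FinUnionPtsIntervals (fiber1 X x ∩ Set.Ioo c d) := by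
  intro m X hX a b
  have hord : IsOrderedAddMonoid R := by
    have key : ∀ x y z : R, x ≤ y → z + x ≤ z + y := by
      intro x y z h
      rcases h.eq_or_lt with h | h
      · rw [h]
      · exact (CovariantClass.elim (μ := fun p q : R => p + q) (r := fun p q : R => p < q) z h).le
    constructor
    · intro x y h z
      first
        | exact key x y z h
        | (rw [add_comm x, add_comm y]; exact key x y z h)
    · intro x y h z
      exact key x y z h
  have hnt : Nontrivial R := by
    obtain ⟨N, -, p, q, -, U, ⟨c, d, rfl⟩, hb, -⟩ :=
      hLUF2 1 ∅ Set.definable_empty a (fun _ => a)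
    exact ⟨c 0, a, (hb 0).1.ne⟩
  have hDL : OC.DL R L := { lt := hlt, add := hadd, dc := hDC, luf := hLUF2 }
  exact OC.final (OC.isDS_of_openCore hX) a b
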